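/- arXiv:2012.15517 — 16 statements merged into one kernel-verified Lean document; each statement's English description precedes it below -/
import Mathlib

section
/- Uniqueness of critical points: suppose (x, λ) and (x', λ') with x, x' ∈ ℝ^n having all components strictly positive and λ, λ' ∈ ℝ^r both satisfy the critical point system: w_i·x_i = ∑_{j=1}^r λ_j·A_{ji} for every i = 1,…,n, and ∑_{i=1}^n A_{ji}·log x_i = log t_j for every j = 1,…,r (and likewise for (x', λ')). Then x = x' and λ = λ'. In particular, the constrained minimization problem f(w,t,A) has at most one minimizer with positive components. -/
theorem sub_mul_log_sub_log_pos {a b : ℝ} (ha : 0 < a) (hb : 0 < b) (hab : a ≠ b) :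
    0 < (a - b) * (Real.log a - Real.log b) := by
  rcases lt_or_gt_of_ne hab with h | h
  · exact mul_pos_of_neg_of_neg (sub_neg.2 h) (sub_neg.2 (Real.log_lt_log ha h))
  · exact mul_pos (sub_pos.2 h) (sub_pos.2 (Real.log_lt_log hb h))

theorem sub_mul_log_sub_log_nonneg {a b : ℝ} (ha : 0 < a) (hb : 0 < b) :
    0 ≤ (a - b) * (Real.log a - Real.log b) := by
  rcases eq_or_ne a b with rfl | h
  · simp
  · exact (sub_mul_log_sub_log_pos ha hb h).le

/-- Uniqueness of critical points for the minimization of `∑ wᵢ xᵢ` under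
log-linear constraints `∑ᵢ A j i * log xᵢ = log t j`. -/
theorem critical_point_unique
    (n r : ℕ) (hn : 1 ≤ n) (hr : 1 ≤ r)
    (w : Fin n → ℝ) (hw : ∀ i, 0 < w i)
    (A : Fin r → Fin n → ℝ) (hA : LinearIndependent ℝ A)
    (t : Fin r → ℝ) (ht : ∀ j, 0 < t j)
    (x x' : Fin n → ℝ) (lam lam' : Fin r → ℝ)
    (hx : ∀ i, 0 < x i) (hx' : ∀ i, 0 < x' i)
    (hcrit : ∀ i, w i * x i = ∑ j, lam j * A j i)
    (hcons : ∀ j, ∑ i, A j i * Real.log (x i) = Real.log (t j))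
    (hcrit' : ∀ i, w i * x' i = ∑ j, lam' j * A j i)
    (hcons' : ∀ j, ∑ i, A j i * Real.log (x' i) = Real.log (t j)) :
    x = x' ∧ lam = lam' := by
  have hdiff : ∀ i, w i * (x i - x' i) = ∑ j, (lam j - lam' j) * A j i := fun i ↦ by
    simp only [mul_sub, sub_mul, hcrit, hcrit', Finset.sum_sub_distrib]
  have hsum : ∑ i, w i * ((x i - x' i) * (Real.log (x i) - Real.log (x' i))) = 0 := by
    simp only [← mul_assoc, hdiff, Finset.sum_mul]
    rw [Finset.sum_comm]
    refine Finset.sum_eq_zero fun j _ ↦ ?_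
    simp only [mul_assoc, ← Finset.mul_sum]
    simp only [mul_sub, Finset.sum_sub_distrib, hcons, hcons', sub_self, mul_zero]
  have hxx : x = x' := by
    funext i
    by_contra h
    have hi := (Finset.sum_eq_zero_iff_of_nonneg fun i _ ↦
      mul_nonneg (hw i).le (sub_mul_log_sub_log_nonneg (hx i) (hx' i))).1 hsum i
        (Finset.mem_univ i)
    exact (mul_pos (hw i) (sub_mul_log_sub_log_pos (hx i) (hx' i) h)).ne' hi
  refine ⟨hxx, funext fun j ↦ sub_eq_zero.1 ?_⟩
  refine Fintype.linearIndependent_iff.1 hA (fun j ↦ lam j - lam' j) ?_ j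
  funext i
  simp only [Finset.sum_apply, Pi.smul_apply, smul_eq_mul, Pi.zero_apply, ← hdiff, hxx,
    sub_self, mul_zero]
end

section
/- Existence of a minimizer: the infimum f(w,t,A) is attained by some admissible vector x if and only if the constraint system is compact, i.e., if and only if there exists c ∈ ℝ^r such that ∑_{j=1}^r c_j·A_{ji} > 0 for every i = 1,…,n. -/
/-- A vector is admissible if it has positive components and satisfies
the log-linear constraints. -/
def Admissible (n r : ℕ) (A : Fin r → Fin n → ℝ) (t : Fin r → ℝ) (x : Fin n → ℝ) : Prop :=
  (∀ i, 0 < x i) ∧ ∀ j, ∑ i, A j i * Real.log (x i) = Real.log (t j)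

/-- The infimum of the linear objective over admissible vectors. -/
noncomputable def fval (n r : ℕ) (w : Fin n → ℝ) (A : Fin r → Fin n → ℝ)
    (t : Fin r → ℝ) : ℝ :=
  sInf {s | ∃ x : Fin n → ℝ, Admissible n r A t x ∧ s = ∑ i, w i * x i}

/-- A matrix with linearly independent rows is surjective as a linear map. -/
theorem exists_mulVec_eq_of_linearIndependent {ι κ : Type*} [Fintype ι] [Fintype κ]
    {A : κ → ι → ℝ} (hA : LinearIndependent ℝ A) (b : κ → ℝ) :
    ∃ y : ι → ℝ, ∀ j, ∑ i, A j i * y i = b j := by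
  have hrank : Matrix.rank (Matrix.of A) = Fintype.card κ := LinearIndependent.rank_matrix hA
  have htop : LinearMap.range (Matrix.of A).mulVecLin = ⊤ :=
    Submodule.eq_top_of_finrank_eq (by rw [Module.finrank_fintype_fun_eq_card]; exact hrank)
  obtain ⟨y, hy⟩ := LinearMap.range_eq_top.mp htop b
  exact ⟨y, fun j => congrFun hy j⟩

/-- A vector orthogonal to the kernel of `A` is a linear combination of the rows of `A`. -/
theorem exists_combination_of_orthogonal_ker {ι κ : Type*} [Fintype ι] [Fintype κ]
    (A : κ → ι → ℝ) (v : ι → ℝ)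
    (h : ∀ d : ι → ℝ, (∀ j, ∑ i, A j i * d i = 0) → ∑ i, v i * d i = 0) :
    ∃ c : κ → ℝ, ∀ i, ∑ j, c j * A j i = v i := by
  classical
  let L : (ι → ℝ) → (ι → ℝ) →ₗ[ℝ] ℝ := dotProductBilin ℝ ℝ
  have hmem : L v ∈ Submodule.span ℝ (Set.range fun j => L (A j)) := by
    apply mem_span_of_iInf_ker_le_ker
    intro d hd
    simp only [Submodule.mem_iInf, LinearMap.mem_ker] at hd ⊢
    exact h d hd
  obtain ⟨c, hc⟩ := (Submodule.mem_span_range_iff_exists_fun ℝ).mp hmem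
  refine ⟨c, fun i => ?_⟩
  have := LinearMap.congr_fun hc (Pi.single i 1)
  simpa [L, LinearMap.sum_apply] using this

/-- First-order optimality for a weighted sum of exponentials along a direction. -/
theorem sum_mul_eq_zero_of_forall_le_sum_exp {ι : Type*} [Fintype ι] (v d : ι → ℝ)
    (h : ∀ s : ℝ, ∑ i, v i ≤ ∑ i, v i * Real.exp (s * d i)) : ∑ i, v i * d i = 0 := by
  have hderiv : HasDerivAt (fun s : ℝ => ∑ i, v i * Real.exp (s * d i)) (∑ i, v i * d i) 0 := by
    apply HasDerivAt.fun_sum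
    intro i _
    simpa using (((hasDerivAt_id (0 : ℝ)).mul_const (d i)).exp).const_mul (v i)
  refine IsLocalMin.hasDerivAt_eq_zero (Filter.Eventually.of_forall fun s => ?_) hderiv
  simpa using h s

/-- A positively weighted sum of exponentials attains its minimum on an affine subspace on which
some functional with positive coefficients is constant. -/
theorem exists_isMinOn_sum_exp {ι κ : Type*} [Fintype ι] [Fintype κ]
    (w : ι → ℝ) (hw : ∀ i, 0 < w i) (A : κ → ι → ℝ) (b : κ → ℝ)
    (hb : ∃ y : ι → ℝ, ∀ j, ∑ i, A j i * y i = b j)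
    (c : κ → ℝ) (hc : ∀ i, 0 < ∑ j, c j * A j i) :
    ∃ y : ι → ℝ, (∀ j, ∑ i, A j i * y i = b j) ∧
      ∀ z : ι → ℝ, (∀ j, ∑ i, A j i * z i = b j) →
        ∑ i, w i * Real.exp (y i) ≤ ∑ i, w i * Real.exp (z i) := by
  classical
  obtain ⟨y₀, hy₀⟩ := hb
  let a : ι → ℝ := fun i => ∑ j, c j * A j i
  let F : (ι → ℝ) → ℝ := fun y => ∑ i, w i * Real.exp (y i)
  have ha : ∀ i, 0 < a i := hc
  have hconst : ∀ y : ι → ℝ, (∀ j, ∑ i, A j i * y i = b j) →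
      ∑ i, a i * y i = ∑ j, c j * b j := by
    intro y hy
    simp only [a, ← hy, Finset.sum_mul, Finset.mul_sum, mul_assoc]
    exact Finset.sum_comm
  let U : ι → ℝ := fun i => Real.log (F y₀ / w i)
  let l : ι → ℝ := fun i =>
    (∑ j, c j * b j - ∑ k ∈ Finset.univ.erase i, a k * U k) / a i
  let K : Set (ι → ℝ) := {y | ∀ j, ∑ i, A j i * y i = b j} ∩ Set.Icc l U
  have hbound : ∀ y : ι → ℝ, (∀ j, ∑ i, A j i * y i = b j) → F y ≤ F y₀ → y ∈ K := by
    intro y hy hle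
    have hU : ∀ i, y i ≤ U i := by
      intro i
      have hterm : w i * Real.exp (y i) ≤ F y :=
        Finset.single_le_sum (f := fun i => w i * Real.exp (y i))
          (fun k _ => (mul_pos (hw k) (Real.exp_pos _)).le) (Finset.mem_univ i)
      have hexp : Real.exp (y i) ≤ F y₀ / w i := by
        rw [le_div_iff₀ (hw i), mul_comm]
        exact hterm.trans hle
      exact (Real.le_log_iff_exp_le ((Real.exp_pos _).trans_le hexp)).mpr hexp
    refine ⟨hy, fun i => ?_, hU⟩
    have hsum := hconst y hy
    rw [← Finset.add_sum_erase _ _ (Finset.mem_univ i)] at hsum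
    have hrest : ∑ k ∈ Finset.univ.erase i, a k * y k ≤ ∑ k ∈ Finset.univ.erase i, a k * U k :=
      Finset.sum_le_sum fun k _ => mul_le_mul_of_nonneg_left (hU k) (ha k).le
    change _ / a i ≤ y i
    rw [div_le_iff₀ (ha i)]
    linarith
  have hclosed : IsClosed {y : ι → ℝ | ∀ j, ∑ i, A j i * y i = b j} := by
    simp only [Set.ofPred_forall]
    exact isClosed_iInter fun j => isClosed_eq (by fun_prop) continuous_const
  have hK : IsCompact K := isCompact_Icc.inter_left hclosed
  have hF : Continuous F := by fun_prop
  obtain ⟨y, hyK, hmin⟩ := hK.exists_isMinOn ⟨y₀, hbound y₀ hy₀ le_rfl⟩ hF.continuousOn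
  refine ⟨y, hyK.1, fun z hz => ?_⟩
  by_cases hle : F z ≤ F y₀
  · exact hmin (hbound z hz hle)
  · exact (hmin (hbound y₀ hy₀ le_rfl)).trans (not_le.mp hle).le

theorem fval_le {n r : ℕ} {w : Fin n → ℝ} (hw : ∀ i, 0 < w i) {A : Fin r → Fin n → ℝ}
    {t : Fin r → ℝ} {x : Fin n → ℝ} (hx : Admissible n r A t x) :
    fval n r w A t ≤ ∑ i, w i * x i := by
  refine csInf_le ⟨0, ?_⟩ ⟨x, hx, rfl⟩
  rintro _ ⟨z, hz, rfl⟩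
  exact Finset.sum_nonneg fun i _ => (mul_pos (hw i) (hz.1 i)).le


/-- The infimum `f(w,t,A)` is attained by some admissible vector iff the
constraint system is compact, i.e. some linear combination of the rows of `A`
has all entries positive. -/
theorem minimizer_exists_iff_compact
    (n r : ℕ) (hn : 1 ≤ n) (hr : 1 ≤ r)
    (w : Fin n → ℝ) (hw : ∀ i, 0 < w i)
    (A : Fin r → Fin n → ℝ) (hA : LinearIndependent ℝ A)
    (t : Fin r → ℝ) (ht : ∀ j, 0 < t j) :
    (∃ x : Fin n → ℝ, Admissible n r A t x ∧ ∑ i, w i * x i = fval n r w A t) ↔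
      (∃ c : Fin r → ℝ, ∀ i, 0 < ∑ j, c j * A j i) := by
  constructor
  · rintro ⟨x, hx, hmin⟩
    obtain ⟨c, hc⟩ := exists_combination_of_orthogonal_ker A (fun i => w i * x i) fun d hd => by
      refine sum_mul_eq_zero_of_forall_le_sum_exp _ d fun s => ?_
      have hadm : Admissible n r A t fun i => x i * Real.exp (s * d i) := by
        refine ⟨fun i => mul_pos (hx.1 i) (Real.exp_pos _), fun j => ?_⟩
        have hlog : ∀ i, A j i * Real.log (x i * Real.exp (s * d i)) =
            A j i * Real.log (x i) + s * (A j i * d i) := fun i => by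
          rw [Real.log_mul (hx.1 i).ne' (Real.exp_pos _).ne', Real.log_exp]
          ring
        simp only [hlog, Finset.sum_add_distrib, ← Finset.mul_sum, hd j, hx.2 j, mul_zero,
          add_zero]
      simpa only [hmin, mul_assoc] using fval_le hw hadm
    exact ⟨c, fun i => hc i ▸ mul_pos (hw i) (hx.1 i)⟩
  · rintro ⟨c, hc⟩
    obtain ⟨y, hy, hmin⟩ := exists_isMinOn_sum_exp w hw A (fun j => Real.log (t j))
      (exists_mulVec_eq_of_linearIndependent hA _) c hc
    have hadm : Admissible n r A t fun i => Real.exp (y i) :=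
      ⟨fun i => Real.exp_pos _, fun j => by simpa only [Real.log_exp] using hy j⟩
    refine ⟨_, hadm, le_antisymm (le_csInf ⟨_, _, hadm, rfl⟩ ?_) (fval_le hw hadm)⟩
    rintro _ ⟨z, hz, rfl⟩
    simpa only [Real.exp_log (hz.1 _)] using hmin (fun i => Real.log (z i)) hz.2
end

section
/- Positivity of the minimum: if there exists c ∈ ℝ^r such that the vector a ∈ ℝ^n defined by a_i = ∑_{j=1}^r c_j·A_{ji} satisfies a_i ≥ 0 for all i and a ≠ 0, then f(w,t,A) > 0. -/
/-- A matrix with linearly independent rows defines a surjective linear map. -/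
theorem Matrix.mulVec_surjective_of_linearIndependent_rows {m n K : Type*} [Fintype m]
    [Fintype n] [Field K] (A : Matrix m n K) (hA : LinearIndependent K A) :
    Function.Surjective A.mulVec := by
  have hrank : A.rank = Fintype.card m := LinearIndependent.rank_matrix hA
  have htop : LinearMap.range A.mulVecLin = ⊤ := by
    apply Submodule.eq_top_of_finrank_eq
    rw [Module.finrank_fintype_fun_eq_card]
    exact hrank
  exact LinearMap.range_eq_top.mp htop

theorem exists_admissible (n r : ℕ) (A : Fin r → Fin n → ℝ) (hA : LinearIndependent ℝ A)
    (t : Fin r → ℝ) : ∃ x, Admissible n r A t x := by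
  obtain ⟨y, hy⟩ := Matrix.mulVec_surjective_of_linearIndependent_rows (Matrix.of A) hA
    (fun j => Real.log (t j))
  refine ⟨fun i => Real.exp (y i), fun i => Real.exp_pos _, fun j => ?_⟩
  simpa [Matrix.mulVec, dotProduct] using congrFun hy j

/-- The logarithms of an admissible vector satisfy every linear combination of the constraints. -/
theorem Admissible.sum_combination {n r : ℕ} {A : Fin r → Fin n → ℝ} {t : Fin r → ℝ}
    {x : Fin n → ℝ} (hx : Admissible n r A t x) (c : Fin r → ℝ) :
    ∑ i, (∑ j, c j * A j i) * Real.log (x i) = ∑ j, c j * Real.log (t j) := by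
  simp_rw [← hx.2, Finset.mul_sum, Finset.sum_mul, mul_assoc]
  exact Finset.sum_comm

/-- Some entry is at least the weighted mean, for nonnegative weights that are not all zero. -/
theorem exists_div_sum_le {ι : Type*} [Fintype ι] (a y : ι → ℝ) (ha : ∀ i, 0 ≤ a i)
    (ha0 : a ≠ 0) : ∃ i, (∑ i, a i * y i) / ∑ i, a i ≤ y i := by
  obtain ⟨k, hk⟩ := Function.ne_iff.mp ha0
  have hkpos : 0 < a k := (ha k).lt_of_ne' hk
  have hS : 0 < ∑ i, a i := Finset.sum_pos' (fun i _ => ha i) ⟨k, Finset.mem_univ k, hkpos⟩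
  by_contra! h
  have hlt : ∑ i, a i * y i < ∑ i, a i * ((∑ i, a i * y i) / ∑ i, a i) :=
    Finset.sum_lt_sum (fun i _ => mul_le_mul_of_nonneg_left (h i).le (ha i))
      ⟨k, Finset.mem_univ k, mul_lt_mul_of_pos_left (h k) hkpos⟩
  rw [← Finset.sum_mul, mul_div_cancel₀ _ hS.ne'] at hlt
  exact lt_irrefl _ hlt

/-- If some nontrivial nonnegative linear combination of the rows of `A` exists,
then the minimum `f(w,t,A)` is strictly positive. -/
theorem fval_pos
    (n r : ℕ) (hn : 1 ≤ n) (hr : 1 ≤ r)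
    (w : Fin n → ℝ) (hw : ∀ i, 0 < w i)
    (A : Fin r → Fin n → ℝ) (hA : LinearIndependent ℝ A)
    (t : Fin r → ℝ) (ht : ∀ j, 0 < t j)
    (hc : ∃ c : Fin r → ℝ,
      (∀ i, 0 ≤ ∑ j, c j * A j i) ∧ (fun i => ∑ j, c j * A j i) ≠ 0) :
    0 < fval n r w A t := by
  obtain ⟨c, ha, ha0⟩ := hc
  have : Nonempty (Fin n) := ⟨⟨0, hn⟩⟩
  obtain ⟨k, hk⟩ := Finite.exists_min w
  obtain ⟨x₀, hx₀⟩ := exists_admissible n r A hA t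
  have hpos : 0 < w k * Real.exp ((∑ j, c j * Real.log (t j)) / ∑ i, ∑ j, c j * A j i) :=
    mul_pos (hw k) (Real.exp_pos _)
  refine hpos.trans_le (le_csInf ⟨_, x₀, hx₀, rfl⟩ ?_)
  rintro s ⟨x, hx, rfl⟩
  obtain ⟨i, hi⟩ := exists_div_sum_le _ (fun i => Real.log (x i)) ha ha0
  rw [hx.sum_combination c, Real.le_log_iff_exp_le (hx.1 i)] at hi
  calc
    _ ≤ w i * x i := mul_le_mul (hk i) hi (Real.exp_pos _).le (hw i).le
    _ ≤ ∑ i, w i * x i :=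
      Finset.single_le_sum (f := fun i => w i * x i)
        (fun i _ => (mul_pos (hw i) (hx.1 i)).le) (Finset.mem_univ i)
end

section
/- Compactness of sublevel sets: suppose there exists c ∈ ℝ^r with ∑_{j=1}^r c_j·A_{ji} > 0 for every i. Then for every real number c₀ the set X_{c₀} = { x ∈ ℝ^n : x admissible and ∑_{i=1}^n w_i x_i ≤ c₀ } is a compact subset of ℝ^n; moreover X_{c₀} is nonempty whenever c₀ > f(w,t,A). -/
/-- In logarithmic coordinates, sublevel sets of the objective are compact. -/
theorem isCompact_log_sublevel (n r : ℕ) (w : Fin n → ℝ) (hw : ∀ i, 0 < w i)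
    (A : Fin r → Fin n → ℝ) (b : Fin r → ℝ)
    (hc : ∃ c : Fin r → ℝ, ∀ i, 0 < ∑ j, c j * A j i) (c₀ : ℝ) :
    IsCompact {y : Fin n → ℝ |
      (∀ j, ∑ i, A j i * y i = b j) ∧ ∑ i, w i * Real.exp (y i) ≤ c₀} := by
  obtain ⟨c, hc⟩ := hc
  set d : Fin n → ℝ := fun i => ∑ j, c j * A j i with hd
  set u : Fin n → ℝ := fun i => Real.log (c₀ / w i)
  set l : Fin n → ℝ := fun i => u i - (∑ k, d k * u k - ∑ j, c j * b j) / d i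
  refine (isCompact_Icc (a := l) (b := u)).of_isClosed_subset ?_ ?_
  · rw [Set.ofPred_and]
    refine IsClosed.inter ?_ (isClosed_le (by fun_prop) continuous_const)
    simp only [Set.ofPred_forall]
    exact isClosed_iInter fun j => isClosed_eq (by fun_prop) continuous_const
  · rintro y ⟨hy, hle⟩
    have hu : ∀ i, y i ≤ u i := fun i => by
      have h : w i * Real.exp (y i) ≤ c₀ :=
        (Finset.single_le_sum (f := fun i => w i * Real.exp (y i))
          (fun k _ => (mul_pos (hw k) (Real.exp_pos _)).le) (Finset.mem_univ i)).trans hle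
      have h' : Real.exp (y i) ≤ c₀ / w i := by
        rw [le_div_iff₀ (hw i)]
        linarith
      exact (Real.le_log_iff_exp_le ((Real.exp_pos _).trans_le h')).2 h'
    have hsum : ∑ k, d k * y k = ∑ j, c j * b j := by
      simp only [hd, ← hy, Finset.mul_sum, Finset.sum_mul]
      rw [Finset.sum_comm]
      simp only [mul_assoc]
    refine ⟨fun i => ?_, hu⟩
    have h : d i * (u i - y i) ≤ ∑ k, d k * (u k - y k) :=
      Finset.single_le_sum (f := fun k => d k * (u k - y k))
        (fun k _ => mul_nonneg (hc k).le (sub_nonneg.2 (hu k))) (Finset.mem_univ i)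
    simp only [mul_sub, Finset.sum_sub_distrib, hsum] at h
    have h' : u i - y i ≤ (∑ k, d k * u k - ∑ j, c j * b j) / d i := by
      rw [le_div_iff₀ (hc i)]
      linarith
    change u i - _ ≤ y i
    linarith

/-- If the constraint system is compact, then every sublevel set of the objective
on the admissible set is compact, and it is nonempty whenever the level exceeds
the infimum `f(w,t,A)`. -/
theorem sublevel_compact
    (n r : ℕ) (hn : 1 ≤ n) (hr : 1 ≤ r)
    (w : Fin n → ℝ) (hw : ∀ i, 0 < w i)
    (A : Fin r → Fin n → ℝ) (hA : LinearIndependent ℝ A)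
    (t : Fin r → ℝ) (ht : ∀ j, 0 < t j)
    (hc : ∃ c : Fin r → ℝ, ∀ i, 0 < ∑ j, c j * A j i)
    (c₀ : ℝ) :
    IsCompact {x : Fin n → ℝ | Admissible n r A t x ∧ ∑ i, w i * x i ≤ c₀} ∧
      (fval n r w A t < c₀ →
        {x : Fin n → ℝ | Admissible n r A t x ∧ ∑ i, w i * x i ≤ c₀}.Nonempty) := by
  constructor
  · have hcont : Continuous fun (y : Fin n → ℝ) (i : Fin n) => Real.exp (y i) := by fun_prop
    convert (isCompact_log_sublevel n r w hw A (fun j => Real.log (t j)) hc c₀).image hcont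
      using 1
    ext x
    constructor
    · rintro ⟨⟨hpos, hx⟩, hle⟩
      exact ⟨fun i => Real.log (x i), ⟨hx, by simpa [Real.exp_log (hpos _)] using hle⟩,
        funext fun i => Real.exp_log (hpos i)⟩
    · rintro ⟨y, ⟨hy, hle⟩, rfl⟩
      exact ⟨⟨fun i => Real.exp_pos _, by simpa using hy⟩, hle⟩
  · intro h
    obtain ⟨x₀, hx₀⟩ := exists_admissible n r A hA t
    have hne : {s | ∃ x : Fin n → ℝ, Admissible n r A t x ∧ s = ∑ i, w i * x i}.Nonempty :=
      ⟨_, x₀, hx₀, rfl⟩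
    obtain ⟨_, ⟨x, hx, rfl⟩, hlt⟩ := exists_lt_of_csInf_lt hne h
    exact ⟨x, hx, hlt.le⟩
end

section
/- Symmetric problems have symmetric minimizers: let σ be a permutation of {1,…,n} such that w_{σ(i)} = w_i for all i and A_{j,σ(i)} = A_{ji} for all i and all j. If x is admissible and ∑_{i=1}^n w_i x_i = f(w,t,A) (i.e., x is a minimizer), then x_{σ(i)} = x_i for all i. -/
/-- Permutation-invariant weights do not see a relabelling of the summand. -/
theorem sum_mul_comp_perm {ι : Type*} [Fintype ι] (σ : Equiv.Perm ι) (c g : ι → ℝ)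
    (hc : ∀ i, c (σ i) = c i) : ∑ i, c i * g (σ i) = ∑ i, c i * g i := by
  rw [← Equiv.sum_comp σ (fun i => c i * g i)]
  simp only [hc]

/-- The geometric mean of an admissible vector and its image under a symmetry of the
constraints is admissible. -/
theorem Admissible.sqrt_mul_sqrt_comp_perm {n r : ℕ} {A : Fin r → Fin n → ℝ} {t : Fin r → ℝ}
    {x : Fin n → ℝ} (hx : Admissible n r A t x) (σ : Equiv.Perm (Fin n))
    (hAσ : ∀ j i, A j (σ i) = A j i) :
    Admissible n r A t (fun i => √(x i) * √(x (σ i))) := by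
  refine ⟨fun i => mul_pos (Real.sqrt_pos.2 (hx.1 i)) (Real.sqrt_pos.2 (hx.1 (σ i))),
    fun j => ?_⟩
  have hlog : ∀ i, A j i * Real.log (√(x i) * √(x (σ i))) =
      (A j i * Real.log (x i) + A j i * Real.log (x (σ i))) / 2 := by
    intro i
    rw [Real.log_mul (Real.sqrt_pos.2 (hx.1 i)).ne' (Real.sqrt_pos.2 (hx.1 (σ i))).ne',
      Real.log_sqrt (hx.1 i).le, Real.log_sqrt (hx.1 (σ i)).le]
    ring
  simp only [hlog]
  rw [← Finset.sum_div, Finset.sum_add_distrib,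
    sum_mul_comp_perm σ (A j) (fun i => Real.log (x i)) (hAσ j), hx.2 j]
  ring

/-- For positive weights, the infimum bounds the objective at every admissible vector. -/
theorem fval_le_sum {n r : ℕ} {w : Fin n → ℝ} (hw : ∀ i, 0 < w i) {A : Fin r → Fin n → ℝ}
    {t : Fin r → ℝ} {z : Fin n → ℝ} (hz : Admissible n r A t z) :
    fval n r w A t ≤ ∑ i, w i * z i := by
  refine csInf_le ⟨0, ?_⟩ ⟨z, hz, rfl⟩
  rintro _ ⟨y, hy, rfl⟩
  exact Finset.sum_nonneg fun i _ => (mul_pos (hw i) (hy.1 i)).le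

/-- A symmetric problem has a symmetric minimizer: if the data are invariant
under a permutation `σ`, then any minimizer is `σ`-invariant. -/
theorem minimizer_symmetric
    (n r : ℕ) (hn : 1 ≤ n) (hr : 1 ≤ r)
    (w : Fin n → ℝ) (hw : ∀ i, 0 < w i)
    (A : Fin r → Fin n → ℝ) (hA : LinearIndependent ℝ A)
    (t : Fin r → ℝ) (ht : ∀ j, 0 < t j)
    (σ : Equiv.Perm (Fin n))
    (hwσ : ∀ i, w (σ i) = w i)
    (hAσ : ∀ j i, A j (σ i) = A j i)
    (x : Fin n → ℝ) (hadm : Admissible n r A t x)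
    (hmin : ∑ i, w i * x i = fval n r w A t) :
    ∀ i, x (σ i) = x i := by
  have hle := fval_le_sum hw (hadm.sqrt_mul_sqrt_comp_perm σ hAσ)
  have hnonneg : ∀ i ∈ Finset.univ, 0 ≤ w i * (√(x i) - √(x (σ i))) ^ 2 :=
    fun i _ => mul_nonneg (hw i).le (sq_nonneg _)
  have hexpand : ∀ i, w i * (√(x i) - √(x (σ i))) ^ 2 =
      w i * x i + w i * x (σ i) - 2 * (w i * (√(x i) * √(x (σ i)))) := by
    intro i
    rw [sub_sq, Real.sq_sqrt (hadm.1 i).le, Real.sq_sqrt (hadm.1 (σ i)).le]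
    ring
  have hsum : ∑ i, w i * (√(x i) - √(x (σ i))) ^ 2 = 0 := by
    refine le_antisymm ?_ (Finset.sum_nonneg hnonneg)
    simp only [hexpand]
    rw [Finset.sum_sub_distrib, Finset.sum_add_distrib, sum_mul_comp_perm σ w x hwσ,
      ← Finset.mul_sum]
    linarith
  intro i
  have hi := (Finset.sum_eq_zero_iff_of_nonneg hnonneg).1 hsum i (Finset.mem_univ i)
  have hsqrt : √(x i) = √(x (σ i)) :=
    sub_eq_zero.1 (pow_eq_zero_iff two_ne_zero |>.1
      ((mul_eq_zero.1 hi).resolve_left (hw i).ne'))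
  exact ((Real.sqrt_inj (hadm.1 i).le (hadm.1 (σ i)).le).1 hsqrt).symm
end

section
/- Minimum for the palm tree: let h ≥ 1 and ℓ ≥ 1 be integers and let t_1,…,t_ℓ > 0. Then inf { ∑_{i=1}^h s_i + ∑_{j=1}^ℓ u_j : s ∈ ℝ^h with s_i > 0, u ∈ ℝ^ℓ with u_j > 0, and (∏_{i=1}^h s_i)·u_j = t_j for every j } = (h+1) · (∑_{j=1}^ℓ t_j)^{1/(h+1)}. -/
/-- The unweighted AM-GM inequality for `h + 1` nonnegative numbers, one of them singled out. -/
theorem Real.mul_rpow_prod_mul_le_sum_add {h : ℕ} {s : Fin h → ℝ} {v : ℝ}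
    (hs : ∀ i, 0 ≤ s i) (hv : 0 ≤ v) :
    ((h : ℝ) + 1) * ((∏ i, s i) * v) ^ ((1 : ℝ) / ((h : ℝ) + 1)) ≤ (∑ i, s i) + v := by
  have key := Real.geom_mean_le_arith_mean Finset.univ (fun _ : Fin (h + 1) ↦ (1 : ℝ))
    (Fin.cons v s) (fun _ _ ↦ zero_le_one) (by simp; positivity)
    (fun i _ ↦ by refine Fin.cases ?_ ?_ i <;> simp [hs, hv])
  simp only [Real.rpow_one, one_mul, Fin.prod_univ_succ, Fin.sum_univ_succ (f := Fin.cons v s),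
    Fin.cons_zero, Fin.cons_succ, Finset.sum_const, Finset.card_univ, Fintype.card_fin,
    nsmul_eq_mul, mul_one, Nat.cast_add, Nat.cast_one] at key
  rw [le_div_iff₀ (by positivity)] at key
  rw [one_div, mul_comm (∏ i, s i)]
  linarith

/-- Minimum of the node sum for the palm tree `Palm` with trunk of length `h`
and `ℓ` leaves, with prescribed maximal chain products `t₁,…,t_ℓ`:
it equals `(h+1) (∑ tⱼ)^(1/(h+1))`. -/
theorem palm_tree_min
    (h ℓ : ℕ) (hh : 1 ≤ h) (hℓ : 1 ≤ ℓ)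
    (t : Fin ℓ → ℝ) (ht : ∀ j, 0 < t j) :
    sInf {S | ∃ (s : Fin h → ℝ) (u : Fin ℓ → ℝ),
        ((∀ i, 0 < s i) ∧ (∀ j, 0 < u j) ∧
          (∀ j, (∏ i, s i) * u j = t j)) ∧
        S = (∑ i, s i) + ∑ j, u j} =
      ((h : ℝ) + 1) * (∑ j, t j) ^ ((1 : ℝ) / ((h : ℝ) + 1)) := by
  refine IsLeast.csInf_eq ⟨?_, ?_⟩
  · have hT : 0 < ∑ j, t j := Finset.sum_pos (fun j _ ↦ ht j) ⟨⟨0, hℓ⟩, Finset.mem_univ _⟩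
    set c := (∑ j, t j) ^ ((1 : ℝ) / ((h : ℝ) + 1)) with hc
    have hc0 : 0 < c := Real.rpow_pos_of_pos hT _
    have hcT : c ^ (h + 1) = ∑ j, t j := by
      rw [hc, one_div, ← Nat.cast_succ, Real.rpow_inv_natCast_pow hT.le h.succ_ne_zero]
    refine ⟨fun _ ↦ c, fun j ↦ t j / c ^ h,
      ⟨fun _ ↦ hc0, fun j ↦ div_pos (ht j) (by positivity), fun j ↦ ?_⟩, ?_⟩
    · simp only [Finset.prod_const, Finset.card_univ, Fintype.card_fin]
      field_simp
    · rw [← Finset.sum_div, ← hcT, pow_succ, mul_div_cancel_left₀ _ (by positivity)]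
      simp
      ring
  · rintro _ ⟨s, u, ⟨hs, hu, hsu⟩, rfl⟩
    simp only [← hsu, ← Finset.mul_sum]
    exact Real.mul_rpow_prod_mul_le_sum_add (fun i ↦ (hs i).le)
      (Finset.sum_nonneg fun j _ ↦ (hu j).le)
end

section
/- Counting cyclic points of random maps (exact formula): for every integer n ≥ 1, ∑_{f : [n] → [n]} #{ i ∈ [n] : i is a periodic point of f, i.e., there exists k ≥ 1 with f^{∘k}(i) = i } = ∑_{k=1}^n (n!/(n−k)!) · n^{n−k}, where the outer sum ranges over all n^n functions from the set [n] = {1,…,n} to itself. -/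
open scoped Classical

open Function Finset

theorem card_filter_forall_mem_eq {α β : Type*} [Fintype α] [DecidableEq α] [Fintype β]
    (s : Finset α) (g : α → β) :
    #{f : α → β | ∀ x ∈ s, f x = g x} = Fintype.card β ^ (Fintype.card α - #s) := by
  have h : ({f : α → β | ∀ x ∈ s, f x = g x} : Finset (α → β)) =
      Fintype.piFinset fun x => if x ∈ s then {g x} else univ := by
    ext f
    simp only [mem_filter, mem_univ, true_and, Fintype.mem_piFinset]
    refine forall_congr' fun x => ?_
    split_ifs with hx <;> simp [hx]
  rw [h, Fintype.card_piFinset, ← card_compl, ← card_univ (α := β), ← prod_const,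
    ← prod_compl_mul_prod s, prod_congr rfl (g := fun _ => #(univ : Finset β)),
    prod_eq_one (s := s), mul_one]
  · intro x hx
    simp [hx]
  · intro x hx
    simp [mem_compl.1 hx]

theorem card_filter_comp_embedding_eq {ι α β : Type*} [Fintype ι] [Fintype α] [DecidableEq α]
    [Fintype β] [Nonempty β] (e : ι ↪ α) (u : ι → β) :
    #{f : α → β | ∀ j, f (e j) = u j} =
      Fintype.card β ^ (Fintype.card α - Fintype.card ι) := by
  have h := card_filter_forall_mem_eq (univ.map e)
    (extend e u fun _ => Classical.arbitrary β)
  simpa [e.injective.extend_apply] using h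

open Fin.NatCast Fin.CommRing in
theorem iterate_apply_eq_of_forall_apply_add_one {α : Type*} {k : ℕ} {f : α → α}
    {e : Fin (k + 1) → α} (h : ∀ j, f (e j) = e (j + 1)) (m : ℕ) : f^[m] (e 0) = e m := by
  induction m with
  | zero => simp
  | succ m ih => rw [iterate_succ_apply', ih, h, Nat.cast_succ]

theorem minimalPeriod_eq_of_forall_apply_add_one {α : Type*} {k : ℕ} {f : α → α}
    {e : Fin (k + 1) → α} (he : Injective e) (h : ∀ j, f (e j) = e (j + 1)) :
    minimalPeriod f (e 0) = k + 1 := by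
  have key : ∀ m, IsPeriodicPt f m (e 0) ↔ k + 1 ∣ m := fun m => by
    rw [IsPeriodicPt, IsFixedPt, iterate_apply_eq_of_forall_apply_add_one h, he.eq_iff,
      Fin.natCast_eq_zero]
  exact Nat.dvd_antisymm ((key _).2 dvd_rfl).minimalPeriod_dvd
    ((key _).1 (isPeriodicPt_minimalPeriod f _))

theorem exists_embedding_of_minimalPeriod_eq {α : Type*} {k : ℕ} {f : α → α} {x : α}
    (h : minimalPeriod f x = k + 1) :
    ∃ e : Fin (k + 1) ↪ α, (∀ j, f (e j) = e (j + 1)) ∧ e 0 = x := by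
  refine ⟨⟨fun j => f^[j] x, fun i j hij => Fin.ext ?_⟩, fun j => ?_, rfl⟩
  · exact iterate_injOn_Iio_minimalPeriod (f := f) (x := x) (i.isLt.trans_eq h.symm)
      (j.isLt.trans_eq h.symm) hij
  · change f (f^[j] x) = f^[(j + 1 : Fin (k + 1))] x
    rw [← iterate_succ_apply' f, Fin.val_add, Fin.val_one', Nat.add_mod_mod]
    exact (h ▸ iterate_mod_minimalPeriod_eq (f := f) (x := x) (n := j + 1)).symm

theorem card_filter_minimalPeriod_eq {α : Type*} [Fintype α] [DecidableEq α] {k : ℕ}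
    (hk : 1 ≤ k) :
    #{p : (α → α) × α | minimalPeriod p.1 p.2 = k} =
      (Fintype.card α).descFactorial k * Fintype.card α ^ (Fintype.card α - k) := by
  obtain ⟨k, rfl⟩ := Nat.exists_eq_add_of_le' hk
  calc
    #{p : (α → α) × α | minimalPeriod p.1 p.2 = k + 1}
      = #((univ : Finset (Fin (k + 1) ↪ α)).sigma
          fun e => ({f : α → α | ∀ j, f (e j) = e (j + 1)} : Finset (α → α))) := by
        symm
        refine card_bij (fun p _ => (p.2, p.1 0)) ?_ ?_ ?_
        · rintro ⟨e, f⟩ h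
          simp only [mem_sigma, mem_univ, mem_filter, true_and] at h ⊢
          exact minimalPeriod_eq_of_forall_apply_add_one e.injective h
        · rintro ⟨e, f⟩ h ⟨e', f'⟩ h' heq
          simp only [mem_sigma, mem_univ, mem_filter, true_and, Prod.mk.injEq] at h h' heq
          obtain ⟨rfl, h0⟩ := heq
          suffices e = e' by rw [this]
          ext j
          rw [← Fin.cast_val_eq_self j, ← iterate_apply_eq_of_forall_apply_add_one h,
            ← iterate_apply_eq_of_forall_apply_add_one h', h0]
        · rintro ⟨f, x⟩ h
          obtain ⟨e, he, h0⟩ := exists_embedding_of_minimalPeriod_eq (by simpa using h)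
          exact ⟨⟨e, f⟩, by simpa using he, by rw [h0]⟩
    _ = ∑ e : Fin (k + 1) ↪ α, Fintype.card α ^ (Fintype.card α - (k + 1)) := by
        rw [card_sigma]
        refine sum_congr rfl fun e _ => ?_
        have : Nonempty α := ⟨e 0⟩
        convert card_filter_comp_embedding_eq e fun j => e (j + 1)
        simp
    _ = _ := by simp [Fintype.card_embedding_eq]

theorem sum_card_periodicPts {α : Type*} [Fintype α] [DecidableEq α] :
    ∑ f : α → α, #{x | x ∈ periodicPts f} = ∑ k ∈ Icc 1 (Fintype.card α),
      (Fintype.card α).descFactorial k * Fintype.card α ^ (Fintype.card α - k) := by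
  have h : ∑ f : α → α, #{x | x ∈ periodicPts f} =
      #{p : (α → α) × α | p.2 ∈ periodicPts p.1} := by
    simp only [card_filter, Fintype.sum_prod_type]
  rw [h, card_eq_sum_card_fiberwise (f := fun p => minimalPeriod p.1 p.2)
    (t := Icc 1 (Fintype.card α))]
  · refine sum_congr rfl fun k hk => ?_
    have hk : 1 ≤ k := (mem_Icc.1 hk).1
    rw [← card_filter_minimalPeriod_eq hk, filter_filter]
    congr 1
    refine filter_congr fun p _ => and_iff_right_of_imp fun hp => ?_
    exact minimalPeriod_pos_iff_mem_periodicPts.1 (by omega)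
  · intro p hp
    simp only [coe_filter, mem_univ, true_and, Set.mem_ofPred_eq] at hp
    exact mem_coe.2 (mem_Icc.2 ⟨minimalPeriod_pos_of_mem_periodicPts hp,
      minimalPeriod_le_card⟩)

/-- Exact count of periodic (cyclic) points over all maps of an `n`-element set
to itself: `∑_f #{periodic points of f} = ∑_{k=1}^n n!/(n-k)! · n^(n-k)`. -/
theorem total_cyclic_points_formula (n : ℕ) (hn : 1 ≤ n) :
    (∑ f : Fin n → Fin n,
        (Finset.univ.filter fun i : Fin n => ∃ k : ℕ, 1 ≤ k ∧ f^[k] i = i).card) =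
      ∑ k ∈ Finset.Icc 1 n, (Nat.factorial n / Nat.factorial (n - k)) * n ^ (n - k) := by
  have h := sum_card_periodicPts (α := Fin n)
  rw [Fintype.card_fin] at h
  refine Eq.trans ?_ (h.trans (sum_congr rfl fun k hk => ?_))
  · rfl
  · rw [Nat.descFactorial_eq_div (mem_Icc.1 hk).2]
end

section
/- Expected number of cyclic points of a random map: define E(n) = n^{−n} · ∑_{f : [n] → [n]} #{ i ∈ [n] : i is a periodic point of f }. Then lim_{n→∞} E(n)/√n = √(π/2); that is, the expected number of cyclic points of a uniformly random function from an n-element set to itself is asymptotic to √(πn/2). -/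
open scoped Classical

/-- The number of self-maps of `α` with prescribed values along an injective family. -/
theorem card_maps_prescribed_along_embedding {ι α : Type*} [Fintype ι] [Fintype α] [DecidableEq α]
    (e : ι ↪ α) (g : ι → α) :
    (Finset.univ.filter fun f : α → α => ∀ j, f (e j) = g j).card =
      Fintype.card α ^ (Fintype.card α - Fintype.card ι) := by
  have key : (Finset.univ.filter fun f : α → α => ∀ j, f (e j) = g j) =
      Fintype.piFinset (fun a : α =>
        if a ∈ Finset.univ.map e then
          Finset.univ.filter (fun b => ∀ j, e j = a → b = g j) else Finset.univ) := by
    ext f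
    simp only [Finset.mem_filter, Finset.mem_univ, true_and, Fintype.mem_piFinset]
    constructor
    · intro h a
      split_ifs
      · simp only [Finset.mem_filter, Finset.mem_univ, true_and]
        rintro j rfl
        exact h j
      · exact Finset.mem_univ _
    · intro h j
      have h1 := h (e j)
      rw [if_pos (by simp)] at h1
      exact (Finset.mem_filter.1 h1).2 j rfl
  rw [key, Fintype.card_piFinset]
  have h2 : ∀ a : α, (if a ∈ Finset.univ.map e then
          Finset.univ.filter (fun b => ∀ j, e j = a → b = g j) else Finset.univ).card =
      if a ∈ Finset.univ.map e then 1 else Fintype.card α := by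
    intro a
    split_ifs with ha
    · obtain ⟨j, -, rfl⟩ := Finset.mem_map.1 ha
      rw [Finset.card_eq_one]
      refine ⟨g j, ?_⟩
      ext b
      simp
    · rfl
  rw [Finset.prod_congr rfl fun a _ => h2 a, Finset.prod_ite, Finset.prod_const_one, one_mul,
    Finset.prod_const]
  congr 1
  rw [Finset.filter_not, Finset.card_sdiff_of_subset (Finset.filter_subset _ _)]
  simp [Finset.card_image_of_injective _ e.injective]

theorem iterate_eq_of_semiconj_cyclic_succ {α : Type*} {m : ℕ} {f : α → α} {e : Fin (m + 1) → α}
    (h : ∀ j, f (e j) = e (j + 1)) (k : ℕ) : f^[k] (e 0) = e (Fin.ofNat (m + 1) k) := by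
  induction k with
  | zero => rfl
  | succ k ih =>
    rw [Function.iterate_succ_apply', ih, h]
    congr 1
    ext
    simp [Fin.val_add]

theorem minimalPeriod_eq_of_semiconj_cyclic_succ {α : Type*} {m : ℕ} {f : α → α}
    (e : Fin (m + 1) ↪ α) (h : ∀ j, f (e j) = e (j + 1)) :
    Function.minimalPeriod f (e 0) = m + 1 := by
  have hp (k : ℕ) : Function.IsPeriodicPt f k (e 0) ↔ m + 1 ∣ k := by
    rw [Function.IsPeriodicPt, Function.IsFixedPt, iterate_eq_of_semiconj_cyclic_succ h,
      e.injective.eq_iff, Fin.ext_iff, Nat.dvd_iff_mod_eq_zero]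
    rfl
  apply Nat.dvd_antisymm
  · exact ((hp _).2 dvd_rfl).minimalPeriod_dvd
  · exact (hp _).1 (Function.isPeriodicPt_minimalPeriod _ _)

/-- The number of pairs of a self-map and a point of minimal period `m + 1`. -/
theorem card_pairs_minimalPeriod_eq (α : Type*) [Fintype α] [DecidableEq α] (m : ℕ) :
    (Finset.univ.filter fun p : (α → α) × α => Function.minimalPeriod p.1 p.2 = m + 1).card =
      (Fintype.card α).descFactorial (m + 1) *
        Fintype.card α ^ (Fintype.card α - (m + 1)) := by
  have h1 : (Finset.univ.filter fun q : (Fin (m + 1) ↪ α) × (α → α) =>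
      ∀ j, q.2 (q.1 j) = q.1 (j + 1)).card =
      (Fintype.card α).descFactorial (m + 1) *
        Fintype.card α ^ (Fintype.card α - (m + 1)) := by
    rw [Finset.card_filter, Fintype.sum_prod_type]
    simp only [← Finset.card_filter]
    trans ∑ e : Fin (m + 1) ↪ α, Fintype.card α ^ (Fintype.card α - (m + 1))
    · refine Finset.sum_congr rfl fun e _ => ?_
      convert card_maps_prescribed_along_embedding e (fun j => e (j + 1))
      simp
    · rw [Finset.sum_const, Finset.card_univ, Fintype.card_embedding_eq, Fintype.card_fin,
        smul_eq_mul]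
  rw [← h1]
  symm
  refine Finset.card_bij (fun q _ => (q.2, q.1 0)) ?_ ?_ ?_
  · intro q hq
    simp only [Finset.mem_filter, Finset.mem_univ, true_and] at hq ⊢
    exact minimalPeriod_eq_of_semiconj_cyclic_succ q.1 hq
  · rintro ⟨e, f⟩ hq ⟨e', f'⟩ hq' heq
    simp only [Finset.mem_filter, Finset.mem_univ, true_and] at hq hq'
    simp only [Prod.mk.injEq] at heq ⊢
    obtain ⟨rfl, h0⟩ := heq
    refine ⟨?_, rfl⟩
    ext j
    have a1 := iterate_eq_of_semiconj_cyclic_succ hq j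
    have a2 := iterate_eq_of_semiconj_cyclic_succ hq' j
    rw [h0, a2] at a1
    simpa using a1.symm
  · rintro ⟨f, i⟩ hp
    simp only [Finset.mem_filter, Finset.mem_univ, true_and] at hp
    have inj : Function.Injective (fun j : Fin (m + 1) => f^[j] i) := by
      intro a b hab
      apply Fin.ext
      exact Function.iterate_injOn_Iio_minimalPeriod (f := f) (x := i)
        (by rw [hp]; exact a.2) (by rw [hp]; exact b.2) hab
    refine ⟨(⟨_, inj⟩, f), ?_, ?_⟩
    · simp only [Finset.mem_filter, Finset.mem_univ, true_and, Function.Embedding.coeFn_mk]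
      intro j
      rw [← Function.iterate_succ_apply' f]
      have h2 : ((j + 1 : Fin (m + 1)) : ℕ) = (j + 1) % Function.minimalPeriod f i := by
        rw [hp, Fin.val_add]
        simp
      rw [h2, Function.iterate_mod_minimalPeriod_eq]
    · simp

/-- The total number of cyclic points of all self-maps of `Fin n`. -/
theorem sum_card_cyclic_points (n : ℕ) :
    ∑ f : Fin n → Fin n, (Finset.univ.filter fun i : Fin n =>
        ∃ k : ℕ, 1 ≤ k ∧ f^[k] i = i).card =
      ∑ m ∈ Finset.range n, n.descFactorial (m + 1) * n ^ (n - (m + 1)) := by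
  have h1 : ∑ f : Fin n → Fin n, (Finset.univ.filter fun i : Fin n =>
        ∃ k : ℕ, 1 ≤ k ∧ f^[k] i = i).card =
      (Finset.univ.filter fun p : (Fin n → Fin n) × Fin n =>
        ∃ k : ℕ, 1 ≤ k ∧ p.1^[k] p.2 = p.2).card := by
    rw [Finset.card_filter, Fintype.sum_prod_type]
    simp only [← Finset.card_filter]
  have h2 : (Finset.univ.filter fun p : (Fin n → Fin n) × Fin n =>
        ∃ k : ℕ, 1 ≤ k ∧ p.1^[k] p.2 = p.2) =
      (Finset.range n).biUnion fun m =>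
        Finset.univ.filter fun p : (Fin n → Fin n) × Fin n =>
          Function.minimalPeriod p.1 p.2 = m + 1 := by
    ext ⟨f, i⟩
    simp only [Finset.mem_filter, Finset.mem_univ, true_and, Finset.mem_biUnion, Finset.mem_range]
    constructor
    · rintro ⟨k, hk, hki⟩
      have hpos : 0 < Function.minimalPeriod f i :=
        Function.IsPeriodicPt.minimalPeriod_pos hk hki
      have hle : Function.minimalPeriod f i ≤ n := by
        have inj : Function.Injective
            (fun j : Fin (Function.minimalPeriod f i) => f^[j] i) := by
          intro a b hab
          exact Fin.ext (Function.iterate_injOn_Iio_minimalPeriod (f := f) (x := i) a.2 b.2 hab)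
        simpa using Fintype.card_le_of_injective _ inj
      exact ⟨Function.minimalPeriod f i - 1, by omega, by omega⟩
    · rintro ⟨m, -, hm⟩
      exact ⟨m + 1, by omega, hm ▸ Function.iterate_minimalPeriod⟩
  rw [h1, h2, Finset.card_biUnion]
  · refine Finset.sum_congr rfl fun m _ => ?_
    simpa using card_pairs_minimalPeriod_eq (Fin n) m
  · intro a _ b _ hab
    refine Finset.disjoint_left.2 fun p hp hq => ?_
    simp only [Finset.mem_filter, Finset.mem_univ, true_and] at hp hq
    omega

/-- The probability that `m + 1` independent uniform points of an `n`-element set are distinct. -/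
noncomputable def birthdayProd (n m : ℕ) : ℝ :=
  ∏ j ∈ Finset.range (m + 1), (1 - (j : ℝ) / n)

theorem descFactorial_mul_pow_div_pow {n m : ℕ} (hm : m < n) :
    ((n.descFactorial (m + 1) * n ^ (n - (m + 1)) : ℕ) : ℝ) / (n : ℝ) ^ n = birthdayProd n m := by
  have hn : (n : ℝ) ≠ 0 := by
    have : 0 < n := by omega
    positivity
  have h1 : (n : ℝ) ^ n = (n : ℝ) ^ (m + 1) * (n : ℝ) ^ (n - (m + 1)) := by
    rw [← pow_add]; congr 1; omega
  push_cast
  rw [h1, mul_div_mul_right _ _ (pow_ne_zero _ hn), Nat.descFactorial_eq_prod_range,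
    birthdayProd, Nat.cast_prod]
  conv_lhs => rw [← Finset.card_range (m + 1), ← Finset.prod_const, Finset.card_range]
  rw [← Finset.prod_div_distrib]
  refine Finset.prod_congr rfl fun j hj => ?_
  have : j ≤ n := by have := Finset.mem_range.1 hj; omega
  rw [Nat.cast_sub this]
  field_simp

theorem birthdayProd_eq_zero {n m : ℕ} (hn : 0 < n) (h : n ≤ m) : birthdayProd n m = 0 := by
  refine Finset.prod_eq_zero (i := n) (Finset.mem_range.2 (by omega)) ?_
  have : (n : ℝ) ≠ 0 := by positivity
  rw [div_self this, sub_self]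

theorem birthdayProd_nonneg (n m : ℕ) (hn : 0 < n) : 0 ≤ birthdayProd n m := by
  rcases le_or_gt n m with h | h
  · rw [birthdayProd_eq_zero hn h]
  · refine Finset.prod_nonneg fun j hj => ?_
    have hj' : (j : ℝ) ≤ n := by
      have := Finset.mem_range.1 hj
      exact_mod_cast (by omega : j ≤ n)
    have : (j : ℝ) / n ≤ 1 := div_le_one_of_le₀ hj' (by positivity)
    linarith

theorem sum_range_succ_cast_div (n m : ℕ) :
    ∑ j ∈ Finset.range (m + 1), (j : ℝ) / n = (m : ℝ) * (m + 1) / (2 * n) := by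
  have h : ∑ j ∈ Finset.range (m + 1), (j : ℝ) = (m : ℝ) * (m + 1) / 2 := by
    induction m with
    | zero => simp
    | succ m ih => rw [Finset.sum_range_succ, ih]; push_cast; ring
  rw [← Finset.sum_div, h, div_div]

theorem birthdayProd_le_exp (n m : ℕ) (hn : 0 < n) :
    birthdayProd n m ≤ Real.exp (-((m : ℝ) * (m + 1) / (2 * n))) := by
  rcases le_or_gt n m with h | h
  · rw [birthdayProd_eq_zero hn h]; positivity
  · rw [← sum_range_succ_cast_div, ← Finset.sum_neg_distrib, Real.exp_sum]
    refine Finset.prod_le_prod (fun j hj => ?_) fun j _ => Real.one_sub_le_exp_neg _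
    have hj' : (j : ℝ) ≤ n := by
      have := Finset.mem_range.1 hj
      exact_mod_cast (by omega : j ≤ n)
    have : (j : ℝ) / n ≤ 1 := div_le_one_of_le₀ hj' (by positivity)
    linarith

theorem exp_neg_add_two_mul_sq_le {t : ℝ} (h0 : 0 ≤ t) (h1 : t ≤ 1 / 2) :
    Real.exp (-(t + 2 * t ^ 2)) ≤ 1 - t := by
  rw [Real.exp_neg]
  have h2 : 1 + (t + 2 * t ^ 2) ≤ Real.exp (t + 2 * t ^ 2) := by
    linarith [Real.add_one_le_exp (t + 2 * t ^ 2)]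
  refine (inv_anti₀ (by positivity) h2).trans ?_
  rw [inv_le_iff_one_le_mul₀ (by positivity)]
  nlinarith [mul_nonneg (sq_nonneg t) (by linarith : (0 : ℝ) ≤ 1 - 2 * t)]

theorem exp_le_birthdayProd (n m : ℕ) (hn : 0 < n) (h : 2 * m ≤ n) :
    Real.exp (-((m : ℝ) * (m + 1) / (2 * n) + (m + 1) * (2 * ((m : ℝ) / n) ^ 2))) ≤
      birthdayProd n m := by
  have hsum : ∑ j ∈ Finset.range (m + 1), ((j : ℝ) / n + 2 * ((m : ℝ) / n) ^ 2) =
      (m : ℝ) * (m + 1) / (2 * n) + (m + 1) * (2 * ((m : ℝ) / n) ^ 2) := by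
    rw [Finset.sum_add_distrib, sum_range_succ_cast_div]
    simp
  rw [← hsum, ← Finset.sum_neg_distrib, Real.exp_sum]
  refine Finset.prod_le_prod (fun j _ => (Real.exp_pos _).le) fun j hj => ?_
  have hjm : j ≤ m := by have := Finset.mem_range.1 hj; omega
  have hjm' : (j : ℝ) / n ≤ (m : ℝ) / n := by gcongr
  have hm : (m : ℝ) / n ≤ 1 / 2 := by
    rw [div_le_iff₀ (by positivity)]
    have : (2 : ℝ) * m ≤ n := by exact_mod_cast h
    linarith
  have h0 : 0 ≤ (j : ℝ) / n := by positivity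
  refine le_trans ?_ (exp_neg_add_two_mul_sq_le h0 (hjm'.trans hm))
  gcongr

theorem tendsto_birthdayProd {x : ℝ} (hx : 0 ≤ x) :
    Filter.Tendsto (fun n : ℕ => birthdayProd n ⌊x * √(n : ℝ)⌋₊) Filter.atTop
      (nhds (Real.exp (-(1 / 2) * x ^ 2))) := by
  have hsq : Filter.Tendsto (fun n : ℕ => √(n : ℝ)) Filter.atTop Filter.atTop :=
    Real.tendsto_sqrt_atTop.comp tendsto_natCast_atTop_atTop
  have hm : Filter.Tendsto (fun n : ℕ => (⌊x * √(n : ℝ)⌋₊ : ℝ) / √(n : ℝ)) Filter.atTop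
      (nhds x) := (tendsto_nat_floor_mul_div_atTop hx).comp hsq
  have hi : Filter.Tendsto (fun n : ℕ => (√(n : ℝ))⁻¹) Filter.atTop (nhds 0) :=
    tendsto_inv_atTop_zero.comp hsq
  have hm1 := hm.add hi
  have hupper : Filter.Tendsto (fun n : ℕ => Real.exp (-((⌊x * √(n : ℝ)⌋₊ : ℝ) *
      (⌊x * √(n : ℝ)⌋₊ + 1) / (2 * n)))) Filter.atTop (nhds (Real.exp (-(1 / 2) * x ^ 2))) := by
    refine (Real.continuous_exp.tendsto _).comp ?_
    have := (hm.mul hm1).const_mul (-(1 / 2))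
    rw [show -(1 / 2) * (x * (x + 0)) = -(1 / 2) * x ^ 2 by ring] at this
    refine this.congr' ?_
    filter_upwards [Filter.eventually_gt_atTop 0] with n hn
    have hs : √(n : ℝ) ≠ 0 := by positivity
    have hs2 : (n : ℝ) = √(n : ℝ) ^ 2 := (Real.sq_sqrt (by positivity)).symm
    generalize (⌊x * √(n : ℝ)⌋₊ : ℝ) = k
    rw [hs2, Real.sqrt_sq (by positivity)]
    field_simp
  have hlower : Filter.Tendsto (fun n : ℕ => Real.exp (-((⌊x * √(n : ℝ)⌋₊ : ℝ) *
      (⌊x * √(n : ℝ)⌋₊ + 1) / (2 * n) + (⌊x * √(n : ℝ)⌋₊ + 1) *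
      (2 * ((⌊x * √(n : ℝ)⌋₊ : ℝ) / n) ^ 2)))) Filter.atTop
      (nhds (Real.exp (-(1 / 2) * x ^ 2))) := by
    refine (Real.continuous_exp.tendsto _).comp ?_
    have := ((hm.mul hm1).const_mul (-(1 / 2))).sub
      (((hm1.mul (hm.pow 2)).mul hi).const_mul 2)
    rw [show -(1 / 2) * (x * (x + 0)) - 2 * ((x + 0) * x ^ 2 * 0) = -(1 / 2) * x ^ 2 by
      ring] at this
    refine this.congr' ?_
    filter_upwards [Filter.eventually_gt_atTop 0] with n hn
    have hs : √(n : ℝ) ≠ 0 := by positivity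
    have hs2 : (n : ℝ) = √(n : ℝ) ^ 2 := (Real.sq_sqrt (by positivity)).symm
    generalize (⌊x * √(n : ℝ)⌋₊ : ℝ) = k
    rw [hs2, Real.sqrt_sq (by positivity)]
    field_simp
    ring
  refine tendsto_of_tendsto_of_tendsto_of_le_of_le' hlower hupper ?_ ?_
  · filter_upwards [Filter.eventually_gt_atTop 0, hsq.eventually_ge_atTop (2 * x)] with n hn hge
    refine exp_le_birthdayProd _ _ hn ?_
    have h1 : (⌊x * √(n : ℝ)⌋₊ : ℝ) ≤ x * √(n : ℝ) := Nat.floor_le (by positivity)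
    have h2 : √(n : ℝ) * √(n : ℝ) = n := Real.mul_self_sqrt (by positivity)
    have h3 : (2 : ℝ) * ⌊x * √(n : ℝ)⌋₊ ≤ n := by
      nlinarith [Real.sqrt_nonneg (n : ℝ)]
    exact_mod_cast h3
  · filter_upwards [Filter.eventually_gt_atTop 0] with n hn
    exact birthdayProd_le_exp _ _ hn

theorem birthdayProd_floor_le {n : ℕ} (hn : 0 < n) {x : ℝ} (hx : 0 ≤ x) :
    birthdayProd n ⌊x * √(n : ℝ)⌋₊ ≤ Real.exp (1 / 4) * Real.exp (-(1 / 4) * x ^ 2) := by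
  refine (birthdayProd_le_exp _ _ hn).trans ?_
  rw [← Real.exp_add]
  apply Real.exp_le_exp.2
  have hs1 : 1 ≤ √(n : ℝ) := Real.one_le_sqrt.2 (by exact_mod_cast hn)
  have hs2 : (n : ℝ) = √(n : ℝ) ^ 2 := (Real.sq_sqrt (by positivity)).symm
  have h1 : x * √(n : ℝ) < ⌊x * √(n : ℝ)⌋₊ + 1 := Nat.lt_floor_add_one _
  have h0 : (0 : ℝ) ≤ ⌊x * √(n : ℝ)⌋₊ := by positivity
  generalize (⌊x * √(n : ℝ)⌋₊ : ℝ) = k at *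
  rw [neg_le, le_div_iff₀ (by positivity)]
  generalize √(n : ℝ) = s at *
  rw [hs2]
  have h2 : x * s * (x * s - 1) ≤ k * (k + 1) := by
    have h3 : 0 ≤ x * s := by positivity
    nlinarith
  have h4 : x * s ≤ x * s ^ 2 := by
    have : 0 ≤ x * s * (s - 1) := by
      have : 0 ≤ s - 1 := by linarith
      positivity
    nlinarith
  nlinarith [sq_nonneg ((x - 1) * s)]

theorem integral_Ioi_comp_floor (a : ℕ → ℝ) (n : ℕ) (ha : ∀ k, n ≤ k → a k = 0) :
    ∫ y in Set.Ioi (0 : ℝ), a ⌊y⌋₊ = ∑ k ∈ Finset.range n, a k := by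
  rw [← MeasureTheory.integral_Ici_eq_integral_Ioi]
  have h1 : ∀ y ∈ Set.Ici (0 : ℝ), a ⌊y⌋₊ = ∑ k ∈ Finset.range n,
      (Set.Ico (k : ℝ) (k + 1)).indicator (fun _ => a k) y := by
    intro y hy
    have h2 : ∀ k : ℕ, (Set.Ico (k : ℝ) (k + 1)).indicator (fun _ => a k) y =
        if ⌊y⌋₊ = k then a k else 0 := by
      intro k
      simp only [Set.indicator_apply, Set.mem_Ico, Nat.floor_eq_iff (Set.mem_Ici.1 hy)]
    simp only [h2, Finset.sum_ite_eq, Finset.mem_range]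
    split_ifs with h
    · rfl
    · exact ha _ (not_lt.1 h)
  rw [MeasureTheory.setIntegral_congr_fun measurableSet_Ici h1,
    MeasureTheory.integral_finsetSum]
  · refine Finset.sum_congr rfl fun k _ => ?_
    rw [MeasureTheory.setIntegral_indicator measurableSet_Ico,
      Set.inter_eq_right.2
        (Set.Ico_subset_Ici_self.trans (Set.Ici_subset_Ici.2 (Nat.cast_nonneg k)))]
    simp
  · intro k _
    apply MeasureTheory.Integrable.integrableOn
    rw [MeasureTheory.integrable_indicator_iff measurableSet_Ico]
    simp

theorem integral_birthdayProd_floor {n : ℕ} (hn : 0 < n) :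
    ∫ x in Set.Ioi (0 : ℝ), birthdayProd n ⌊x * √(n : ℝ)⌋₊ =
      (∑ m ∈ Finset.range n, birthdayProd n m) / √(n : ℝ) := by
  have hs : 0 < √(n : ℝ) := by positivity
  rw [MeasureTheory.integral_comp_mul_right_Ioi (fun y => birthdayProd n ⌊y⌋₊) 0 hs, zero_mul,
    integral_Ioi_comp_floor _ n fun k hk => birthdayProd_eq_zero hn hk, smul_eq_mul,
    inv_mul_eq_div]

theorem tendsto_integral_birthdayProd_floor :
    Filter.Tendsto (fun n : ℕ => ∫ x in Set.Ioi (0 : ℝ), birthdayProd n ⌊x * √(n : ℝ)⌋₊)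
      Filter.atTop (nhds (∫ x in Set.Ioi (0 : ℝ), Real.exp (-(1 / 2) * x ^ 2))) := by
  refine MeasureTheory.tendsto_integral_filter_of_dominated_convergence
    (fun x => Real.exp (1 / 4) * Real.exp (-(1 / 4) * x ^ 2)) ?_ ?_ ?_ ?_
  · refine Filter.Eventually.of_forall fun n => Measurable.aestronglyMeasurable ?_
    exact (measurable_from_top (f := birthdayProd n)).comp
      (Nat.measurable_floor.comp (measurable_id.mul_const _))
  · filter_upwards [Filter.eventually_gt_atTop 0] with n hn
    filter_upwards [MeasureTheory.ae_restrict_mem measurableSet_Ioi] with x hx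
    rw [Real.norm_of_nonneg (birthdayProd_nonneg _ _ hn)]
    exact birthdayProd_floor_le hn (le_of_lt hx)
  · exact ((integrable_exp_neg_mul_sq (by norm_num : (0 : ℝ) < 1 / 4)).const_mul _).integrableOn
  · filter_upwards [MeasureTheory.ae_restrict_mem measurableSet_Ioi] with x hx
    exact tendsto_birthdayProd (le_of_lt hx)

/-- The expected number of cyclic points of a uniformly random map of an
`n`-element set to itself is asymptotic to `√(πn/2)`. -/
theorem expected_cyclic_points_asymptotics :
    Filter.Tendsto
      (fun n : ℕ =>
        ((∑ f : Fin n → Fin n,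
            ((Finset.univ.filter fun i : Fin n =>
              ∃ k : ℕ, 1 ≤ k ∧ f^[k] i = i).card : ℝ)) / (n : ℝ) ^ n) /
          Real.sqrt n)
      Filter.atTop (nhds (Real.sqrt (Real.pi / 2))) := by
  have hlim := tendsto_integral_birthdayProd_floor
  have hval : √(Real.pi / (1 / 2)) / 2 = √(Real.pi / 2) := by
    rw [show Real.pi / (1 / 2) = 2 ^ 2 * (Real.pi / 2) by ring,
      Real.sqrt_mul (by positivity), Real.sqrt_sq (by positivity)]
    ring
  rw [integral_gaussian_Ioi, hval] at hlim
  refine hlim.congr' ?_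
  filter_upwards [Filter.eventually_gt_atTop 0] with n hn
  rw [integral_birthdayProd_floor hn]
  congr 1
  rw [← Nat.cast_sum, sum_card_cyclic_points, Nat.cast_sum, Finset.sum_div]
  exact Finset.sum_congr rfl fun m hm =>
    (descFactorial_mul_pow_div_pow (Finset.mem_range.1 hm)).symm
end

section
/- Equality of the quotient-sum minimum and the cyclic-constraint minimum: let Γ = (𝒱, 𝒜, α, β) be a finite directed multigraph with 𝒱 nonempty, and let w : 𝒜 → ℝ with w_a > 0 for all a. Then inf { ∑_{a∈𝒜} w_a · y(α(a))/y(β(a)) : y : 𝒱 → ℝ with y(v) > 0 for all v } = inf { ∑_{a∈𝒜} w_a·x_a : x : 𝒜 → ℝ with x_a > 0 for all a and x has unit cycle products }. -/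
/-- A positive arc-value function has unit cycle products if its product over
every closed walk (nonempty chain of consecutive arcs returning to its start)
equals `1`. -/
def UnitCycleProducts {V A : Type*} [Fintype A] (α β : A → V) (x : A → ℝ) : Prop :=
  ∀ (k : ℕ) (a : Fin (k + 1) → A),
    (∀ i : Fin k, β (a i.castSucc) = α (a i.succ)) →
    β (a (Fin.last k)) = α (a 0) →
    ∏ i, x (a i) = 1

/-- `IsWalk α β u l v` says that the arcs in `l` form a (possibly empty) walk from `u` to `v`. -/
def IsWalk {V A : Type*} (α β : A → V) : V → List A → V → Prop
  | u, [], v => u = v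
  | u, a :: l, v => α a = u ∧ IsWalk α β (β a) l v

namespace IsWalk

variable {V A : Type*} {α β : A → V}

theorem append_iff {l₁ l₂ : List A} {u v : V} :
    IsWalk α β u (l₁ ++ l₂) v ↔ ∃ z, IsWalk α β u l₁ z ∧ IsWalk α β z l₂ v := by
  induction l₁ generalizing u with
  | nil => simp [IsWalk]
  | cons a l ih => simp [IsWalk, ih, and_assoc]

theorem of_ofFn {k : ℕ} {a : Fin (k + 1) → A} {u v : V}
    (h : IsWalk α β u (List.ofFn a) v) :
    α (a 0) = u ∧ (∀ i : Fin k, β (a i.castSucc) = α (a i.succ)) ∧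
      β (a (Fin.last k)) = v := by
  induction k generalizing u with
  | zero => simpa [IsWalk] using h
  | succ k ih =>
    rw [List.ofFn_succ] at h
    obtain ⟨h₀, h₁, h₂⟩ := ih h.2
    refine ⟨h.1, fun i => ?_, h₂⟩
    cases i using Fin.cases with
    | zero => exact h₀.symm
    | succ i => exact h₁ i

theorem prod_eq_one [Fintype A] {x : A → ℝ} (hx : UnitCycleProducts α β x)
    {l : List A} {u : V} (h : IsWalk α β u l u) : (l.map x).prod = 1 := by
  obtain ⟨n, a, rfl⟩ : ∃ n, ∃ a : Fin n → A, l = List.ofFn a :=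
    ⟨l.length, l.get, (List.ofFn_get l).symm⟩
  cases n with
  | zero => simp
  | succ k =>
    obtain ⟨h₀, h₁, h₂⟩ := h.of_ofFn
    rw [List.map_ofFn, List.prod_ofFn]
    exact hx k a h₁ (h₂.trans h₀.symm)

/-- Removing closed subwalks turns every walk into one without repeated arcs and with the
same product. -/
theorem exists_nodup [Fintype A] {x : A → ℝ} (hx : UnitCycleProducts α β x)
    {l : List A} {u v : V} (h : IsWalk α β u l v) :
    ∃ l', l'.Nodup ∧ IsWalk α β u l' v ∧ (l'.map x).prod = (l.map x).prod := by
  induction hn : l.length using Nat.strong_induction_on generalizing l with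
  | _ n ih =>
    by_cases hd : l.Nodup
    · exact ⟨l, hd, h, rfl⟩
    · obtain ⟨a, l₁, l₂, l₃, rfl⟩ : ∃ a l₁ l₂ l₃, l = l₁ ++ ((a :: l₂) ++ (a :: l₃)) := by
        clear ih h hn
        induction l with
        | nil => simp at hd
        | cons b l ih =>
          by_cases hb : b ∈ l
          · obtain ⟨s, t, rfl⟩ := List.append_of_mem hb
            exact ⟨b, [], s, t, rfl⟩
          · obtain ⟨a, l₁, l₂, l₃, rfl⟩ := ih fun hl => hd (List.nodup_cons.2 ⟨hb, hl⟩)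
            exact ⟨a, b :: l₁, l₂, l₃, rfl⟩
      obtain ⟨z, h₁, h₂⟩ := append_iff.1 h
      obtain ⟨z', h₂, h₃⟩ := append_iff.1 h₂
      obtain rfl : z = z' := h₂.1.symm.trans h₃.1
      obtain ⟨l', hl', hw, hp⟩ := ih (l₁ ++ a :: l₃).length
        (by simp only [List.length_append, List.length_cons] at hn ⊢; omega)
        (append_iff.2 ⟨z, h₁, h₃⟩) rfl
      refine ⟨l', hl', hw, hp.trans ?_⟩
      simp only [List.map_append, List.prod_append, h₂.prod_eq_one hx, one_mul]

end IsWalk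

/-- Arc values with unit cycle products dominate the quotients of some positive node values:
take for each node the least product of a walk starting there. -/
theorem UnitCycleProducts.exists_quotient_le {V A : Type*} [Fintype A] {α β : A → V}
    {x : A → ℝ} (hx : UnitCycleProducts α β x) (hpos : ∀ a, 0 < x a) :
    ∃ y : V → ℝ, (∀ v, 0 < y v) ∧ ∀ a, y (α a) / y (β a) ≤ x a := by
  classical
  have hprod (l : List A) : 0 < (l.map x).prod :=
    List.prod_pos fun r hr => by
      obtain ⟨a, -, rfl⟩ := List.mem_map.1 hr
      exact hpos a
  have hmin (u : V) : ∃ l : List A, (∃ v, IsWalk α β u l v) ∧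
      ∀ l' v, IsWalk α β u l' v → (l.map x).prod ≤ (l'.map x).prod := by
    have hfin : {l : List A | l.Nodup ∧ ∃ v, IsWalk α β u l v}.Finite :=
      (List.finite_length_le A (Fintype.card A)).subset fun l hl => hl.1.length_le_card
    obtain ⟨l, hl, hle⟩ := Set.exists_min_image _ (fun l => (l.map x).prod) hfin
      ⟨[], List.nodup_nil, u, rfl⟩
    refine ⟨l, hl.2, fun l' v h => ?_⟩
    obtain ⟨l'', hd, hw, hp⟩ := h.exists_nodup hx
    exact (hle l'' ⟨hd, v, hw⟩).trans_eq hp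
  choose m hm hle using hmin
  refine ⟨fun v => ((m v).map x).prod, fun v => hprod _, fun a => ?_⟩
  rw [div_le_iff₀ (hprod _)]
  obtain ⟨v, hv⟩ := hm (β a)
  simpa using hle (α a) (a :: m (β a)) v ⟨rfl, hv⟩

theorem unitCycleProducts_quotient {V A : Type*} [Fintype A] (α β : A → V) {y : V → ℝ}
    (hy : ∀ v, 0 < y v) : UnitCycleProducts α β fun a => y (α a) / y (β a) := by
  intro k a h₁ h₂
  have hβ : ∏ i, y (β (a i)) = ∏ i, y (α (a i)) := by
    rw [Fin.prod_univ_castSucc, Fin.prod_univ_succ, h₂, mul_comm]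
    simp only [h₁]
  rw [Finset.prod_div_distrib, hβ]
  exact div_self (Finset.prod_pos fun i _ => hy _).ne'


/-- The infimum of the weighted quotient sum `∑_a w_a y(α a)/y(β a)` over
positive node values equals the infimum of `∑_a w_a x_a` over positive arc
values with unit cycle products. -/
theorem quotient_sum_min_eq_cyclic_min
    {V A : Type*} [Fintype V] [Fintype A] [Nonempty V]
    (α β : A → V) (w : A → ℝ) (hw : ∀ a, 0 < w a) :
    sInf {s | ∃ y : V → ℝ, (∀ v, 0 < y v) ∧
        s = ∑ a : A, w a * (y (α a) / y (β a))} =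
      sInf {s | ∃ x : A → ℝ, ((∀ a, 0 < x a) ∧ UnitCycleProducts α β x) ∧
        s = ∑ a : A, w a * x a} := by
  apply le_antisymm
  · refine le_csInf ⟨_, 1, ⟨fun _ => one_pos, fun k a _ _ => by simp⟩, rfl⟩ ?_
    rintro _ ⟨x, ⟨hpos, hx⟩, rfl⟩
    obtain ⟨y, hy, hle⟩ := hx.exists_quotient_le hpos
    refine csInf_le_of_le ⟨0, ?_⟩ ⟨y, hy, rfl⟩
      (Finset.sum_le_sum fun a _ => mul_le_mul_of_nonneg_left (hle a) (hw a).le)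
    rintro _ ⟨z, hz, rfl⟩
    exact Finset.sum_nonneg fun a _ => mul_nonneg (hw a).le (div_pos (hz _) (hz _)).le
  · refine csInf_le_csInf ⟨0, ?_⟩ ⟨_, 1, fun _ => one_pos, rfl⟩ ?_
    · rintro _ ⟨x, ⟨hpos, -⟩, rfl⟩
      exact Finset.sum_nonneg fun a _ => mul_nonneg (hw a).le (hpos a).le
    · rintro _ ⟨y, hy, rfl⟩
      exact ⟨_, ⟨fun a => div_pos (hy _) (hy _), unitCycleProducts_quotient α β hy⟩, rfl⟩
end

section
/- Maximum value and Eulerian characterization: let Γ = (𝒱, 𝒜, α, β) be a strongly connected finite directed multigraph with m = |𝒜| arcs. Then f_Γ ≤ m, and f_Γ = m holds if and only if Γ is Eulerian, i.e., if and only if every vertex v ∈ 𝒱 satisfies #{ a ∈ 𝒜 : α(a) = v } = #{ a ∈ 𝒜 : β(a) = v }. -/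
open scoped Classical

/-- Strong connectivity of a directed multigraph given by `α, β : A → V`. -/
def StronglyConnected {V A : Type*} (α β : A → V) : Prop :=
  ∀ u v : V, u ≠ v → ∃ (k : ℕ) (a : Fin (k + 1) → A),
    α (a 0) = u ∧ β (a (Fin.last k)) = v ∧
    ∀ i : Fin k, β (a i.castSucc) = α (a i.succ)

/-- The minimum total of arc values subject to unit cycle products. -/
noncomputable def fGamma {V A : Type*} [Fintype A] (α β : A → V) : ℝ :=
  sInf {s | ∃ x : A → ℝ, ((∀ a, 0 < x a) ∧ UnitCycleProducts α β x) ∧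
    s = ∑ a : A, x a}

/-- `WalkSum α β y u v s` says that some, possibly empty, walk from `u` to `v` has total
`y`-weight `s`. -/
inductive WalkSum {V A : Type*} (α β : A → V) (y : A → ℝ) : V → V → ℝ → Prop
  | nil (u : V) : WalkSum α β y u u 0
  | cons (a : A) {v : V} {s : ℝ} (h : WalkSum α β y (β a) v s) : WalkSum α β y (α a) v (y a + s)

namespace WalkSum

variable {V A : Type*} {α β : A → V} {y : A → ℝ}

theorem trans {u v w : V} {s t : ℝ} (h : WalkSum α β y u v s) (h' : WalkSum α β y v w t) :
    WalkSum α β y u w (s + t) := by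
  induction h with
  | nil u => simpa using h'
  | cons a _ ih => simpa only [add_assoc] using cons a (ih h')

theorem of_arc (a : A) : WalkSum α β y (α a) (β a) (y a) := by
  simpa using cons a (nil (y := y) (β a))

theorem of_fin (k : ℕ) (a : Fin (k + 1) → A)
    (ha : ∀ i : Fin k, β (a i.castSucc) = α (a i.succ)) :
    WalkSum α β y (α (a 0)) (β (a (Fin.last k))) (∑ i, y (a i)) := by
  induction k with
  | zero => simpa using of_arc (a 0)
  | succ k ih =>
    rw [Fin.sum_univ_succ]
    refine cons (a 0) ?_
    have h0 : β (a 0) = α (a (Fin.succ 0)) := ha 0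
    rw [h0]
    exact ih (fun i => a i.succ) fun i => ha i.succ

theorem eq_or_exists_fin {u v : V} {s : ℝ} (h : WalkSum α β y u v s) :
    (u = v ∧ s = 0) ∨ ∃ (k : ℕ) (a : Fin (k + 1) → A),
      α (a 0) = u ∧ β (a (Fin.last k)) = v ∧
      (∀ i : Fin k, β (a i.castSucc) = α (a i.succ)) ∧ s = ∑ i, y (a i) := by
  induction h with
  | nil u => exact Or.inl ⟨rfl, rfl⟩
  | cons b _ ih =>
    right
    rcases ih with ⟨hv, hs⟩ | ⟨k, a, h0, hl, hc, hs⟩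
    · exact ⟨0, fun _ => b, rfl, hv, fun i => i.elim0, by simp [hs]⟩
    · refine ⟨k + 1, Fin.cons b a, rfl, ?_, ?_, ?_⟩
      · rw [← Fin.succ_last, Fin.cons_succ, hl]
      · intro i
        refine Fin.cases ?_ (fun j => ?_) i
        · simpa using h0.symm
        · rw [← Fin.succ_castSucc, Fin.cons_succ, Fin.cons_succ, hc]
      · rw [Fin.sum_univ_succ, hs]
        simp

end WalkSum

theorem StronglyConnected.exists_walkSum {V A : Type*} {α β : A → V}
    (hsc : StronglyConnected α β) (y : A → ℝ) (u v : V) : ∃ s, WalkSum α β y u v s := by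
  by_cases huv : u = v
  · exact huv ▸ ⟨0, .nil u⟩
  · obtain ⟨k, a, rfl, rfl, hc⟩ := hsc u v huv
    exact ⟨_, .of_fin k a hc⟩

/-- On a strongly connected graph, the logarithm of a positive function with unit cycle products
is the coboundary of a potential. -/
theorem UnitCycleProducts.exists_potential {V A : Type*} [Fintype A] {α β : A → V} {x : A → ℝ}
    (hx : UnitCycleProducts α β x) (hsc : StronglyConnected α β) (hpos : ∀ a, 0 < x a) :
    ∃ q : V → ℝ, ∀ a, Real.log (x a) = q (β a) - q (α a) := by
  have closed {u : V} {s : ℝ} (h : WalkSum α β (fun a => Real.log (x a)) u u s) : s = 0 := by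
    rcases h.eq_or_exists_fin with ⟨-, hs⟩ | ⟨k, a, h0, hl, hc, rfl⟩
    · exact hs
    · rw [← Real.log_prod fun i _ => (hpos (a i)).ne', hx k a hc (hl.trans h0.symm), Real.log_one]
  rcases isEmpty_or_nonempty V with hV | ⟨⟨r⟩⟩
  · exact ⟨fun _ => 0, fun a => hV.elim (α a)⟩
  choose q hq using hsc.exists_walkSum (fun a => Real.log (x a)) r
  refine ⟨q, fun a => ?_⟩
  obtain ⟨t, ht⟩ := hsc.exists_walkSum (fun a => Real.log (x a)) (β a) r
  have h1 := closed (((hq (α a)).trans (.of_arc a)).trans ht)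
  have h2 := closed ((hq (β a)).trans ht)
  linarith

theorem unitCycleProducts_exp_sub {V A : Type*} [Fintype A] (α β : A → V) (q : V → ℝ) :
    UnitCycleProducts α β fun a => Real.exp (q (β a) - q (α a)) := by
  intro k a hc hl
  rw [← Real.exp_sum, Finset.sum_sub_distrib, Fin.sum_univ_castSucc,
    Fin.sum_univ_succ fun i => q (α (a i))]
  simp [hc, hl, add_comm]

theorem fGamma_le_sum {V A : Type*} [Fintype A] {α β : A → V} {x : A → ℝ}
    (hpos : ∀ a, 0 < x a) (hx : UnitCycleProducts α β x) : fGamma α β ≤ ∑ a, x a := by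
  refine csInf_le ⟨0, ?_⟩ ⟨x, ⟨hpos, hx⟩, rfl⟩
  rintro _ ⟨z, ⟨hz, -⟩, rfl⟩
  exact Finset.sum_nonneg fun a _ => (hz a).le

theorem fGamma_le_card {V A : Type*} [Fintype A] (α β : A → V) :
    fGamma α β ≤ (Fintype.card A : ℝ) := by
  simpa using fGamma_le_sum (α := α) (β := β) (x := fun _ => 1) (fun _ => one_pos)
    (fun _ _ _ _ => by simp)

theorem card_le_fGamma_of_eulerian {V A : Type*} [Fintype V] [Fintype A] {α β : A → V}
    (hsc : StronglyConnected α β)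
    (hE : ∀ v : V, (Finset.univ.filter fun a : A => α a = v).card =
      (Finset.univ.filter fun a : A => β a = v).card) :
    (Fintype.card A : ℝ) ≤ fGamma α β := by
  refine le_csInf ⟨_, fun _ => 1, ⟨fun _ => one_pos, fun _ _ _ _ => by simp⟩, rfl⟩ ?_
  rintro _ ⟨x, ⟨hpos, hx⟩, rfl⟩
  obtain ⟨q, hq⟩ := hx.exists_potential hsc hpos
  have fiber (γ : A → V) :
      ∑ a, q (γ a) = ∑ v, ((Finset.univ.filter fun a : A => γ a = v).card : ℝ) * q v := by
    rw [← Finset.sum_fiberwise Finset.univ γ]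
    refine Finset.sum_congr rfl fun v _ => ?_
    rw [← nsmul_eq_mul, ← Finset.sum_const]
    exact Finset.sum_congr rfl fun a ha => by rw [(Finset.mem_filter.mp ha).2]
  have hlog : ∑ a, Real.log (x a) = 0 := by
    simp only [hq, Finset.sum_sub_distrib, fiber, hE, sub_self]
  have hle : ∑ a, Real.log (x a) ≤ ∑ a, (x a - 1) :=
    Finset.sum_le_sum fun a _ => Real.log_le_sub_one_of_pos (hpos a)
  simp only [Finset.sum_sub_distrib, Finset.sum_const, Finset.card_univ, nsmul_eq_mul,
    mul_one] at hle
  linarith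

/-- If the constant function `1` is optimal, then the total coboundary of every potential
vanishes. -/
theorem sum_sub_eq_zero_of_fGamma_eq_card {V A : Type*} [Fintype A] {α β : A → V}
    (h : fGamma α β = (Fintype.card A : ℝ)) (q : V → ℝ) :
    ∑ a, (q (β a) - q (α a)) = 0 := by
  have hmin : IsLocalMin (fun s : ℝ => ∑ a, Real.exp (s * (q (β a) - q (α a)))) 0 := by
    refine Filter.Eventually.of_forall fun s => ?_
    have hs := fGamma_le_sum (fun a => Real.exp_pos _)
      (unitCycleProducts_exp_sub α β fun v => s * q v)
    simpa [h, mul_sub] using hs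
  have hderiv : HasDerivAt (fun s : ℝ => ∑ a, Real.exp (s * (q (β a) - q (α a))))
      (∑ a, (q (β a) - q (α a))) 0 := by
    refine HasDerivAt.fun_sum fun a _ => ?_
    simpa using ((hasDerivAt_id (0 : ℝ)).mul_const (q (β a) - q (α a))).exp
  exact hmin.hasDerivAt_eq_zero hderiv

/-- For a strongly connected graph with `m` arcs, `f_Γ ≤ m`, with equality iff
the graph is Eulerian (each vertex has equal in- and out-degree). -/
theorem fGamma_le_card_and_eq_iff_eulerian
    {V A : Type*} [Fintype V] [Fintype A] (α β : A → V)
    (hsc : StronglyConnected α β) :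
    fGamma α β ≤ (Fintype.card A : ℝ) ∧
      (fGamma α β = (Fintype.card A : ℝ) ↔
        ∀ v : V, (Finset.univ.filter fun a : A => α a = v).card =
          (Finset.univ.filter fun a : A => β a = v).card) := by
  refine ⟨fGamma_le_card α β, fun h v => ?_, fun hE =>
    (fGamma_le_card α β).antisymm (card_le_fGamma_of_eulerian hsc hE)⟩
  have hv := sum_sub_eq_zero_of_fGamma_eq_card h fun w => if w = v then 1 else 0
  rw [Finset.sum_sub_distrib, Finset.sum_boole, Finset.sum_boole, sub_eq_zero] at hv
  exact_mod_cast hv.symm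
end

section
/- Explicit logarithmic lower bound: let Γ = (𝒱, 𝒜, α, β) be a strongly connected finite directed multigraph with m = |𝒜| ≥ 1 arcs. Then f_Γ > e · ln(m − ln m). -/
open Finset in
/-- Through every arc `b` of a strongly connected graph there is a closed walk starting with `b`
whose arcs are pairwise distinct. -/
theorem StronglyConnected.exists_injOn_closedWalk {V A : Type*} {α β : A → V}
    (hsc : StronglyConnected α β) (b : A) :
    ∃ (k : ℕ) (w : ℕ → A), w 0 = b ∧ (∀ i < k, β (w i) = α (w (i + 1))) ∧
      β (w k) = α (w 0) ∧ Set.InjOn w (range (k + 1)) := by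
  classical
  let P : ℕ → Prop := fun k => ∃ w : ℕ → A, w 0 = b ∧
    (∀ i < k, β (w i) = α (w (i + 1))) ∧ β (w k) = α (w 0)
  have hP : ∃ k, P k := by
    by_cases hb : β b = α b
    · exact ⟨0, fun _ => b, rfl, by simp, hb⟩
    · obtain ⟨k, a, h0, hlast, hstep⟩ := hsc _ _ hb
      refine ⟨k + 1, fun n => Nat.casesOn n b fun n => if h : n < k + 1 then a ⟨n, h⟩ else b,
        rfl, ?_, ?_⟩
      · rintro (_ | i) hi
        · simpa using h0.symm
        · have h1 : i < k := by omega
          have h2 : i < k + 1 := by omega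
          simpa [h1, h2] using hstep ⟨i, h1⟩
      · simpa [Fin.last] using hlast
  obtain ⟨w, h0, hstep, hlast⟩ := Nat.find_spec hP
  set k := Nat.find hP
  refine ⟨k, w, h0, hstep, hlast, ?_⟩
  have key : ∀ i j, i < j → j ≤ k → w i ≠ w j := by
    intro i j hij hjk heq
    refine Nat.find_min hP (m := k - (j - i)) (by omega)
      ⟨fun n => if n ≤ i then w n else w (n + (j - i)), by simpa using h0, ?_, ?_⟩
    · intro n hn
      rcases lt_trichotomy n i with h | rfl | h
      · simpa [h.le, Nat.succ_le_of_lt h] using hstep n (by omega)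
      · have h1 : n + 1 + (j - n) = j + 1 := by omega
        simpa [h1, heq] using hstep j (by omega)
      · have h1 : n + 1 + (j - i) = n + (j - i) + 1 := by omega
        simpa [h.not_ge, show ¬ n + 1 ≤ i by omega, h1] using hstep (n + (j - i)) (by omega)
    · by_cases h : k - (j - i) ≤ i
      · have h1 : k - (j - i) = i := by omega
        obtain rfl : j = k := by omega
        simpa only [h1, le_refl, if_true, heq, Nat.zero_le] using hlast
      · have h1 : k - (j - i) + (j - i) = k := by omega
        simpa [h, h1] using hlast
  intro i hi j hj heq
  simp only [coe_range, Set.mem_Iio] at hi hj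
  rcases lt_trichotomy i j with h | h | h
  · exact (key i j h (by omega) heq).elim
  · exact h
  · exact (key j i h (by omega) heq.symm).elim

/-- The exponential lies above its tangent line at `s`, in logarithmic coordinates. -/
theorem exp_mul_le_of_pos {z : ℝ} (hz : 0 < z) (s : ℝ) :
    Real.exp s * (1 + Real.log z - s) ≤ z := by
  calc Real.exp s * (1 + Real.log z - s)
      ≤ Real.exp s * Real.exp (Real.log z - s) := by
        gcongr
        linarith [Real.add_one_le_exp (Real.log z - s)]
    _ = z := by rw [← Real.exp_add, add_sub_cancel, Real.exp_log hz]

open Finset in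
theorem exists_mul_exp_le_sum {V A : Type*} [Fintype A] {α β : A → V}
    (hsc : StronglyConnected α β) (hm : 1 ≤ Fintype.card A) {x : A → ℝ}
    (hx : ∀ a, 0 < x a) (hcyc : UnitCycleProducts α β x) :
    ∃ K ∈ Icc 1 (Fintype.card A),
      (K : ℝ) * Real.exp (Real.log ((Fintype.card A : ℝ) + 1 - K) / K) ≤ ∑ a, x a := by
  classical
  have : Nonempty A := Fintype.card_pos_iff.mp hm
  obtain ⟨b, -, hb⟩ := exists_min_image univ x univ_nonempty
  obtain ⟨k, w, rfl, hstep, hlast, hinj⟩ := hsc.exists_injOn_closedWalk b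
  set m := Fintype.card A
  have hcard : ((range (k + 1)).image w).card = k + 1 := by
    rw [card_image_of_injOn hinj, card_range]
  have hkm : k + 1 ≤ m := hcard ▸ card_le_univ _
  refine ⟨k + 1, mem_Icc.2 ⟨by omega, hkm⟩, ?_⟩
  have hkm' : (k : ℝ) + 1 ≤ m := by exact_mod_cast hkm
  have hN : (0 : ℝ) < m + 1 - (k + 1 : ℕ) := by push_cast; linarith
  have hK : (0 : ℝ) < (k + 1 : ℕ) := by positivity
  set N : ℝ := m + 1 - (k + 1 : ℕ) with hNdef
  set s : ℝ := Real.log N / (k + 1 : ℕ) with hs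
  have hprod : ∏ i ∈ range (k + 1), x (w i) = 1 := by
    rw [prod_range]
    exact hcyc k (fun i => w i) (fun i => by simpa using hstep i i.2) (by simpa using hlast)
  have hlog : ∑ i ∈ range (k + 1), Real.log (x (w i)) = 0 := by
    rw [← Real.log_prod (fun i _ => (hx _).ne'), hprod, Real.log_one]
  have hsum : ∑ i ∈ range (k + 1), x (w i) + (m - (k + 1 : ℕ)) * x (w 0) ≤ ∑ a, x a := by
    rw [← sum_add_sum_compl ((range (k + 1)).image w), sum_image hinj]
    gcongr
    have := card_nsmul_le_sum ((range (k + 1)).image w)ᶜ x (x (w 0)) fun a _ => hb a (mem_univ a)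
    rwa [card_compl, hcard, nsmul_eq_mul, Nat.cast_sub hkm] at this
  rw [sum_range_succ'] at hlog hsum
  have htail : Real.exp s * (k + ∑ i ∈ range k, Real.log (x (w (i + 1))) - k * s)
      ≤ ∑ i ∈ range k, x (w (i + 1)) := by
    have := sum_le_sum fun i (_ : i ∈ range k) => exp_mul_le_of_pos (hx (w (i + 1))) s
    rw [← mul_sum] at this
    simpa [sum_add_distrib, sum_sub_distrib] using this
  have hhead := exp_mul_le_of_pos (mul_pos hN (hx (w 0))) s
  rw [Real.log_mul hN.ne' (hx _).ne'] at hhead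
  have hKs : Real.log N = (k + 1) * s := by
    rw [hs]; push_cast; field_simp
  have hcomb : ((k + 1 : ℕ) : ℝ) * Real.exp s =
      Real.exp s * (k + ∑ i ∈ range k, Real.log (x (w (i + 1))) - k * s) +
        Real.exp s * (1 + (Real.log N + Real.log (x (w 0))) - s) := by
    rw [hKs, eq_neg_of_add_eq_zero_left hlog]; push_cast; ring
  rw [hcomb]
  have hNx : N * x (w 0) = x (w 0) + (m - (k + 1 : ℕ)) * x (w 0) := by rw [hNdef]; ring
  linarith

/-- For `u ≠ K`, the strict tangent inequality `e u < K exp (u / K)`. -/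
theorem exp_one_mul_lt_mul_exp_div {K u : ℝ} (hK : 0 < K) (h : u ≠ K) :
    Real.exp 1 * u < K * Real.exp (u / K) := by
  have h1 : u / K - 1 ≠ 0 := by
    rwa [sub_ne_zero, Ne, div_eq_one_iff_eq hK.ne']
  have h2 := Real.add_one_lt_exp h1
  calc Real.exp 1 * u = K * (Real.exp 1 * (u / K)) := by field_simp
    _ < K * (Real.exp 1 * Real.exp (u / K - 1)) := by
      gcongr
      linarith
    _ = K * Real.exp (u / K) := by rw [← Real.exp_add, add_sub_cancel]

theorem monotoneOn_log_add_log_div {m : ℝ} (hm : 1 ≤ m) :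
    MonotoneOn (fun K : ℝ => Real.log K + Real.log (m + 1 - K) / K)
      (Set.Icc (1 + Real.log m) m) := by
  have hlm := Real.log_nonneg hm
  have hderiv : ∀ K ∈ Set.Icc (1 + Real.log m) m,
      HasDerivAt (fun K : ℝ => Real.log K + Real.log (m + 1 - K) / K)
        (K⁻¹ + (-1 / (m + 1 - K) * K - Real.log (m + 1 - K) * 1) / K ^ 2) K := by
    rintro K ⟨h1, h2⟩
    have hK : K ≠ 0 := by linarith
    have hN : m + 1 - K ≠ 0 := by linarith
    exact (Real.hasDerivAt_log hK).add
      ((((hasDerivAt_id K).const_sub (m + 1)).log hN).div (hasDerivAt_id K) hK)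
  refine monotoneOn_of_deriv_nonneg (convex_Icc _ _)
    (fun K hK => (hderiv K hK).continuousAt.continuousWithinAt)
    (fun K hK => (hderiv K (interior_subset hK)).differentiableAt.differentiableWithinAt) ?_
  intro K hK
  rw [(hderiv K (interior_subset hK)).deriv]
  obtain ⟨h1, h2⟩ := interior_subset hK
  have hK0 : 0 < K := by linarith
  set N := m + 1 - K
  have hN1 : 1 ≤ N := by linarith
  have hNm : N ≤ m := by linarith
  have hN0 : 0 < N := by linarith
  have hlogN : Real.log N ≤ N - 1 := Real.log_le_sub_one_of_pos hN0
  have hlogm : Real.log N ≤ Real.log m := Real.log_le_log hN0 hNm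
  have hnum : 0 ≤ K * (N - 1) - N * Real.log N := by nlinarith
  have : K⁻¹ + (-1 / N * K - Real.log N * 1) / K ^ 2
      = (K * (N - 1) - N * Real.log N) / (N * K ^ 2) := by
    field_simp
    ring
  rw [this]
  positivity

theorem exp_one_mul_log_sub_log_lt {m K : ℝ} (hK : 1 ≤ K) (hKm : K ≤ m) :
    Real.exp 1 * Real.log (m - Real.log m) < K * Real.exp (Real.log (m + 1 - K) / K) := by
  have hm : 1 ≤ m := hK.trans hKm
  have hlm := Real.log_nonneg hm
  have hlm' : Real.log m ≤ m - 1 := Real.log_le_sub_one_of_pos (by linarith)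
  have hpos : 0 < m - Real.log m := by linarith
  have hu : Real.log (m - Real.log m) ≤ Real.log m := Real.log_le_log hpos (by linarith)
  rcases lt_or_ge K (1 + Real.log m) with h | h
  · have h1 : Real.log (m - Real.log m) < Real.log (m + 1 - K) :=
      Real.log_lt_log hpos (by linarith)
    calc Real.exp 1 * Real.log (m - Real.log m)
        < Real.exp 1 * Real.log (m + 1 - K) := by gcongr
      _ ≤ K * Real.exp (Real.log (m + 1 - K) / K) := by
        by_cases heq : Real.log (m + 1 - K) = K
        · rw [heq, div_self (by linarith), mul_comm]
        · exact (exp_one_mul_lt_mul_exp_div (by linarith) heq).le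
  · refine (exp_one_mul_lt_mul_exp_div (K := 1 + Real.log m) (by linarith)
      (by linarith)).trans_le ?_
    have hmono := monotoneOn_log_add_log_div hm ⟨le_rfl, by linarith⟩ ⟨h, hKm⟩ h
    have hexp := Real.exp_le_exp.2 hmono
    simp only [Real.exp_add] at hexp
    rwa [Real.exp_log (by linarith), Real.exp_log (by linarith),
      show m + 1 - (1 + Real.log m) = m - Real.log m by ring] at hexp

/-- Explicit logarithmic lower bound: for a strongly connected graph with
`m ≥ 1` arcs, `f_Γ > e · ln(m - ln m)`. -/
theorem fGamma_log_lower_bound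
    {V A : Type*} [Fintype V] [Fintype A] (α β : A → V)
    (hsc : StronglyConnected α β) (hm : 1 ≤ Fintype.card A) :
    fGamma α β >
      Real.exp 1 * Real.log ((Fintype.card A : ℝ) - Real.log (Fintype.card A)) := by
  obtain ⟨K, hK, hmin⟩ := Finset.exists_min_image (Finset.Icc 1 (Fintype.card A))
    (fun K : ℕ => (K : ℝ) * Real.exp (Real.log ((Fintype.card A : ℝ) + 1 - K) / K))
    (Finset.nonempty_Icc.2 hm)
  obtain ⟨hK1, hKm⟩ := Finset.mem_Icc.1 hK
  refine (exp_one_mul_log_sub_log_lt (K := K) (by exact_mod_cast hK1)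
    (by exact_mod_cast hKm)).trans_le (le_csInf ?_ ?_)
  · exact ⟨_, fun _ => 1, ⟨fun _ => one_pos, fun _ _ _ _ => by simp⟩, rfl⟩
  · rintro _ ⟨x, ⟨hx, hcyc⟩, rfl⟩
    obtain ⟨L, hL, hle⟩ := exists_mul_exp_le_sum hsc hm hx hcyc
    exact (hmin L hL).trans hle
end

section
/- Asymptotics of the extremal minimum over strongly connected graphs: for each integer m ≥ 1 let M(m) := inf { f_Γ : Γ a strongly connected finite directed multigraph with exactly m arcs (and at most m vertices) }. Then there exists a constant C > 0 such that for all integers m ≥ 2, |M(m) − e·ln m| ≤ C/ln m. -/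
/-- The extremal minimum of `f_Γ` over strongly connected multigraphs with
exactly `m` arcs (and at most `m` vertices). -/
noncomputable def extremalMin (m : ℕ) : ℝ :=
  sInf {s | ∃ (k : ℕ) (α β : Fin m → Fin k), 1 ≤ k ∧ k ≤ m ∧
    StronglyConnected α β ∧ s = fGamma α β}

open Real Finset

/-- Arc values that are ratios of a positive vertex potential have unit cycle products. -/
theorem UnitCycleProducts.of_potential {V A : Type*} [Fintype A] (α β : A → V) (p : V → ℝ)
    (hp : ∀ v, 0 < p v) : UnitCycleProducts α β (fun a => p (β a) / p (α a)) := by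
  intro k a h hc
  have h1 : ∏ i, p (β (a i)) = ∏ i, p (α (a i)) := by
    rw [Fin.prod_univ_castSucc, Fin.prod_univ_succ (fun i => p (α (a i))), hc, mul_comm]
    congr 1
    exact Finset.prod_congr rfl fun i _ => by rw [h i]
  rw [Finset.prod_div_distrib, h1]
  exact div_self (Finset.prod_ne_zero_iff.2 fun i _ => (hp _).ne')

/-- Two distinct vertices of a strongly connected graph are joined by a walk without
repeated arcs. -/
theorem StronglyConnected.exists_injOn_walk {V A : Type*} {α β : A → V}
    (h : StronglyConnected α β) {u v : V} (huv : u ≠ v) :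
    ∃ (k : ℕ) (a : ℕ → A), α (a 0) = u ∧ β (a k) = v ∧
      (∀ i < k, β (a i) = α (a (i + 1))) ∧ Set.InjOn a (Finset.range (k + 1)) := by
  classical
  have hex : ∃ (k : ℕ) (a : ℕ → A), α (a 0) = u ∧ β (a k) = v ∧
      ∀ i < k, β (a i) = α (a (i + 1)) := by
    obtain ⟨k, a, h0, hk, hs⟩ := h u v huv
    refine ⟨k, fun i => a (Fin.ofNat (k + 1) i), ?_, ?_, ?_⟩
    · simpa using h0
    · have : Fin.ofNat (k + 1) k = Fin.last k := by ext; simp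
      simpa only [this] using hk
    · intro i hi
      have h1 : Fin.ofNat (k + 1) i = (⟨i, hi⟩ : Fin k).castSucc := by
        ext; simp; omega
      have h2 : Fin.ofNat (k + 1) (i + 1) = (⟨i, hi⟩ : Fin k).succ := by
        ext; simp; omega
      simpa only [h1, h2] using hs ⟨i, hi⟩
  obtain ⟨a, h0, hk, hs⟩ := Nat.find_spec hex
  refine ⟨Nat.find hex, a, h0, hk, hs, ?_⟩
  have key : ∀ i j, i < j → j ≤ Nat.find hex → a i ≠ a j := by
    intro i j hij hj heq
    refine Nat.find_min hex (m := Nat.find hex - (j - i)) (by omega)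
      ⟨fun n => if n ≤ i then a n else a (n + (j - i)), ?_, ?_, ?_⟩
    · simpa using h0
    · rcases hj.eq_or_lt with hj | hj
      · have : Nat.find hex - (j - i) = i := by omega
        simp only [this, le_refl, if_true]
        rw [heq, hj, hk]
      · beta_reduce
        rw [if_neg (by omega), Nat.sub_add_cancel (by omega), hk]
    · intro n hn
      beta_reduce
      rcases lt_trichotomy n i with h1 | rfl | h1
      · rw [if_pos (by omega), if_pos (by omega)]
        exact hs n (by omega)
      · rw [if_pos le_rfl, if_neg (by omega), heq, hs j (by omega)]
        congr 2; omega
      · rw [if_neg (by omega), if_neg (by omega), hs _ (by omega)]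
        congr 2; omega
  intro i hi j hj heq
  simp only [Finset.coe_range, Set.mem_Iio] at hi hj
  by_contra hne
  rcases Nat.lt_or_gt_of_ne hne with h' | h'
  · exact key i j h' (by omega) heq
  · exact key j i h' (by omega) heq.symm

theorem exp_one_mul_log_le {y : ℝ} (hy : 0 < y) : exp 1 * log y ≤ y := by
  have h := log_le_sub_one_of_pos (div_pos hy (exp_pos 1))
  rw [log_div hy.ne' (exp_pos 1).ne', log_exp] at h
  have h2 : log y ≤ y / exp 1 := by linarith
  rw [le_div_iff₀ (exp_pos 1)] at h2
  linarith

/-- Every arc `a₀` of value less than one lies on a closed walk; the arcs of the rest of this walk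
can be taken distinct, and their values multiply to `1 / x a₀`. -/
theorem exists_return_arcs {V A : Type*} [Fintype A] {α β : A → V}
    (h : StronglyConnected α β) {x : A → ℝ} (hx : ∀ a, 0 < x a) (hu : UnitCycleProducts α β x)
    {a₀ : A} (ha : x a₀ < 1) : ∃ P : Finset A, ∑ a ∈ P, log (x a) = -log (x a₀) := by
  classical
  have hne : β a₀ ≠ α a₀ := by
    intro hloop
    have := hu 0 (fun _ => a₀) (fun i => i.elim0) hloop
    simp at this
    linarith
  obtain ⟨k, a, h0, hk, hs, hinj⟩ := h.exists_injOn_walk hne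
  refine ⟨(Finset.range (k + 1)).image a, ?_⟩
  rw [Finset.sum_image hinj]
  have hprod := hu (k + 1) (fun i => if (i : ℕ) ≤ k then a i else a₀) ?_ ?_
  · rw [Fin.prod_univ_eq_prod_range (fun i => x (if i ≤ k then a i else a₀)),
      Finset.prod_range_succ, if_neg (by omega)] at hprod
    rw [Finset.prod_congr rfl (g := fun i => x (a i))
      (fun i hi => by rw [if_pos (by have := Finset.mem_range.1 hi; omega)])] at hprod
    have := congrArg log hprod
    rw [log_mul (Finset.prod_ne_zero_iff.2 fun i _ => (hx _).ne') (hx _).ne',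
      log_prod (fun i _ => (hx _).ne'), log_one] at this
    linarith
  · intro i
    have hi := i.2
    simp only [Fin.val_castSucc, Fin.val_succ]
    rw [if_pos (by omega)]
    rcases Nat.lt_or_ge i k with h1 | h1
    · rw [if_pos (by omega), hs _ h1]
    · have : (i : ℕ) = k := by omega
      rw [if_neg (by omega), this, hk]
  · simp [h0]

/-- Admissible arc values sum to at least `e * log m`, or to at least `e * log (m - j)` for
some `j < e * log m`, where `m` is the number of arcs. -/
theorem sum_ge_of_unitCycleProducts {V A : Type*} [Fintype A] [Nonempty A] {α β : A → V}
    (h : StronglyConnected α β) {x : A → ℝ} (hx : ∀ a, 0 < x a) (hu : UnitCycleProducts α β x) :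
    exp 1 * log (Fintype.card A) ≤ ∑ a, x a ∨
    ∃ j : ℝ, 0 ≤ j ∧ j < exp 1 * log (Fintype.card A) ∧
      (j < Fintype.card A → exp 1 * log (Fintype.card A - j) ≤ ∑ a, x a) := by
  classical
  obtain ⟨a₀, hmin⟩ := Finite.exists_min x
  have hm : (0 : ℝ) < Fintype.card A := by exact_mod_cast Fintype.card_pos
  rcases le_or_gt 1 (x a₀) with h1 | h1
  · left
    calc exp 1 * log (Fintype.card A) ≤ Fintype.card A := exp_one_mul_log_le hm
      _ = ∑ _a : A, (1 : ℝ) := by simp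
      _ ≤ _ := Finset.sum_le_sum fun a _ => h1.trans (hmin a)
  · obtain ⟨P, hP⟩ := exists_return_arcs h hx hu h1
    have hlog : log (x a₀) < 0 := log_neg (hx _) h1
    have hPe : exp 1 * -log (x a₀) ≤ ∑ a ∈ P, x a := by
      rw [← hP, Finset.mul_sum]
      exact Finset.sum_le_sum fun a _ => exp_one_mul_log_le (hx a)
    have hPc : (P.card : ℝ) ≤ ∑ a ∈ P, x a := by
      have h2 : ∑ a ∈ P, (1 + log (x a)) ≤ ∑ a ∈ P, x a :=
        Finset.sum_le_sum fun a _ => by linarith [log_le_sub_one_of_pos (hx a)]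
      rw [Finset.sum_add_distrib, hP] at h2
      simp at h2
      linarith
    have hsplit := Finset.sum_add_sum_compl P x
    have hcompl : (Fintype.card A - P.card : ℝ) * x a₀ ≤ ∑ a ∈ Pᶜ, x a := by
      have h2 := Finset.card_nsmul_le_sum Pᶜ x (x a₀) fun a _ => hmin a
      rw [nsmul_eq_mul, Finset.card_compl, Nat.cast_sub (Finset.card_le_univ P)] at h2
      exact h2
    have hnonneg : 0 ≤ ∑ a ∈ Pᶜ, x a := Finset.sum_nonneg fun a _ => (hx a).le
    rcases le_or_gt (exp 1 * log (Fintype.card A)) P.card with h2 | h2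
    · left; linarith
    · refine Or.inr ⟨P.card, by positivity, h2, fun h3 => ?_⟩
      have h4 : (0 : ℝ) < Fintype.card A - P.card := by linarith
      have h5 := exp_one_mul_log_le (mul_pos h4 (hx a₀))
      rw [log_mul h4.ne' (hx a₀).ne'] at h5
      linarith

/-- Replacing `m` by `m - j` with `j < e * log m` changes `e * log m` by `O(1 / log m)`. -/
theorem log_sub_lower_bound {m j s : ℝ} (hm : 2 ≤ m) (hs : 0 ≤ s) (hj0 : 0 ≤ j)
    (hj : j < exp 1 * log m) (h : j < m → exp 1 * log (m - j) ≤ s) :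
    exp 1 * log m - 64 * exp 1 ^ 3 / log m ≤ s := by
  have hL : 0 < log m := log_pos (by linarith)
  have he : 1 ≤ exp 1 := one_le_exp (by norm_num)
  have hr : 0 < √m := sqrt_pos.2 (by linarith)
  have hrr : √m * √m = m := mul_self_sqrt (by linarith)
  have hlr : log m ≤ 2 * √m := by
    have h1 := log_le_sub_one_of_pos hr
    rw [log_sqrt (by linarith)] at h1
    linarith
  rw [sub_le_iff_le_add, ← sub_le_iff_le_add', le_div_iff₀ hL]
  rcases le_or_gt j (m / 2) with h1 | h1
  · have hmj : 0 < m - j := by linarith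
    have h2 := h (by linarith)
    have h3 : log m - log (m - j) ≤ 2 * j / m := by
      rw [← log_div (by linarith) hmj.ne']
      have h4 := log_le_sub_one_of_pos (div_pos (by linarith : 0 < m) hmj)
      have h5 : m / (m - j) - 1 = j / (m - j) := by field_simp; ring
      have h6 : j / (m - j) ≤ 2 * j / m := by
        rw [div_le_div_iff₀ hmj (by linarith)]
        nlinarith
      linarith
    have h7 : 2 * j / m * log m ≤ 8 * exp 1 := by
      rw [div_mul_eq_mul_div, div_le_iff₀ (by linarith)]
      have : log m * log m ≤ 4 * m := by nlinarith
      nlinarith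
    have h8 : exp 1 * log m - s ≤ exp 1 * (2 * j / m) := by nlinarith
    calc (exp 1 * log m - s) * log m ≤ exp 1 * (2 * j / m) * log m := by gcongr
      _ = exp 1 * (2 * j / m * log m) := by ring
      _ ≤ exp 1 * (8 * exp 1) := by gcongr
      _ ≤ 64 * exp 1 ^ 3 := by nlinarith [mul_pos (exp_pos 1) (exp_pos 1)]
  · have h2 : √m ≤ 4 * exp 1 := by
      have h3 : √m * √m ≤ 4 * exp 1 * √m := by nlinarith
      exact le_of_mul_le_mul_right h3 hr
    have h3 : log m ≤ 8 * exp 1 := by linarith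
    calc (exp 1 * log m - s) * log m ≤ exp 1 * log m * log m := by gcongr; linarith
      _ ≤ exp 1 * (8 * exp 1) * (8 * exp 1) := by gcongr
      _ = 64 * exp 1 ^ 3 := by ring

/-- A directed path on `n` vertices, with all the other arcs going from its end to its start. -/
theorem extremalMin_le {m n : ℕ} (hn : 1 ≤ n) (hnm : n ≤ m) :
    extremalMin m ≤ n * exp (log m / n) := by
  have hm : (0 : ℝ) < m := by exact_mod_cast (by omega : 0 < m)
  have hn0 : (0 : ℝ) < n := by exact_mod_cast hn
  let α : Fin m → Fin n := fun j => ⟨min j (n - 1), by omega⟩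
  let β : Fin m → Fin n := fun j => ⟨if (j : ℕ) < n - 1 then j + 1 else 0, by split_ifs <;> omega⟩
  set t := exp (log m / n) with ht
  have ht0 : 0 < t := exp_pos _
  have htn : t ^ n = m := by
    rw [ht, ← exp_nat_mul, mul_div_cancel₀ _ hn0.ne', exp_log hm]
  have hsc : StronglyConnected α β := by
    intro u v huv
    have huv' : (u : ℕ) ≠ v := fun h => huv (Fin.ext h)
    have hu := u.2
    have hv := v.2
    obtain ⟨k, hk, huk⟩ : ∃ k < n, u + k + 1 = (v : ℕ) ∨ u + k + 1 = (v : ℕ) + n := by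
      rcases Nat.lt_or_gt_of_ne huv' with h | h
      · exact ⟨v - u - 1, by omega, by omega⟩
      · exact ⟨v + n - u - 1, by omega, by omega⟩
    refine ⟨k, fun s => ⟨if (u + s : ℕ) < n then u + s else u + s - n, ?_⟩, ?_, ?_, ?_⟩
    · have := s.2
      split_ifs <;> omega
    · ext; simp [α]; omega
    · ext; simp only [β, Fin.val_last]; split_ifs <;> omega
    · intro s
      have := s.2
      ext; simp only [α, β, Fin.val_castSucc, Fin.val_succ]
      split_ifs <;> omega
  have hbdd : ∀ {k : ℕ} (α β : Fin m → Fin k), BddBelow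
      {s | ∃ x : Fin m → ℝ, ((∀ a, 0 < x a) ∧ UnitCycleProducts α β x) ∧ s = ∑ a, x a} := by
    intro k α β
    refine ⟨0, ?_⟩
    rintro _ ⟨x, ⟨hx, -⟩, rfl⟩
    exact Finset.sum_nonneg fun a _ => (hx a).le
  have h1 : extremalMin m ≤ fGamma α β := by
    refine csInf_le ⟨0, ?_⟩ ⟨n, α, β, hn, hnm, hsc, rfl⟩
    rintro _ ⟨k, α, β, -, -, -, rfl⟩
    refine Real.sInf_nonneg ?_
    rintro _ ⟨x, ⟨hx, -⟩, rfl⟩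
    exact Finset.sum_nonneg fun a _ => (hx a).le
  have hp : ∀ v : Fin n, 0 < t ^ (v : ℕ) := fun v => pow_pos ht0 _
  have h2 : fGamma α β ≤ ∑ a, t ^ (β a : ℕ) / t ^ (α a : ℕ) :=
    csInf_le (hbdd α β) ⟨_, ⟨fun a => div_pos (hp _) (hp _),
      UnitCycleProducts.of_potential α β (fun v => t ^ (v : ℕ)) hp⟩, rfl⟩
  refine h1.trans (h2.trans ?_)
  have h3 : ∀ a : Fin m, t ^ (β a : ℕ) / t ^ (α a : ℕ) ≤
      (if (a : ℕ) < n - 1 then t else 0) + t / m := by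
    intro a
    simp only [α, β]
    split_ifs with h
    · rw [min_eq_left (by omega), pow_succ, mul_div_cancel_left₀ _ (pow_pos ht0 _).ne']
      have : 0 < t / m := by positivity
      linarith
    · rw [min_eq_right (by omega), ← htn]
      obtain ⟨k, rfl⟩ : ∃ k, n = k + 1 := ⟨n - 1, by omega⟩
      rw [pow_succ, Nat.add_sub_cancel, zero_add, pow_zero]
      exact le_of_eq (by field_simp)
  refine (Finset.sum_le_sum fun a _ => h3 a).trans (le_of_eq ?_)
  rw [Finset.sum_add_distrib, Fin.sum_univ_eq_sum_range (fun i => if i < n - 1 then t else 0) m,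
    ← Finset.sum_filter]
  have h4 : (Finset.range m).filter (· < n - 1) = Finset.range (n - 1) := by
    ext i; simp; omega
  rw [h4]
  simp [Nat.cast_sub hn]
  field_simp
  ring

theorem natCeil_mul_exp_le {L : ℝ} (hL : 0 < L) :
    (⌈L⌉₊ : ℝ) * exp (L / ⌈L⌉₊) ≤ exp 1 * L + exp 1 / L := by
  set n : ℝ := (⌈L⌉₊ : ℝ)
  have hn : L ≤ n := Nat.le_ceil L
  have hn1 : n < L + 1 := Nat.ceil_lt_add_one hL.le
  have hn0 : 0 < n := hL.trans_le hn
  have h1 : exp (L / n) ≤ exp 1 * (n / (2 * n - L)) := by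
    have h2 : (2 * n - L) / n ≤ exp (1 - L / n) := by
      have := add_one_le_exp (1 - L / n)
      have h3 : (2 * n - L) / n = 1 - L / n + 1 := by field_simp; ring
      linarith
    have h4 : exp 1 = exp (L / n) * exp (1 - L / n) := by rw [← exp_add]; ring_nf
    rw [mul_div_assoc', le_div_iff₀ (by linarith), h4]
    rw [div_le_iff₀ hn0] at h2
    nlinarith [exp_pos (L / n)]
  have h5 : n * (n / (2 * n - L)) ≤ L + 1 / L := by
    rw [mul_div_assoc', div_le_iff₀ (by linarith)]
    have h6 : 1 / L * (2 * n - L) ≥ 1 := by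
      rw [ge_iff_le, div_mul_eq_mul_div, le_div_iff₀ hL]; linarith
    nlinarith
  calc n * exp (L / n) ≤ n * (exp 1 * (n / (2 * n - L))) := by gcongr
    _ = exp 1 * (n * (n / (2 * n - L))) := by ring
    _ ≤ exp 1 * (L + 1 / L) := by gcongr
    _ = _ := by ring

theorem le_extremalMin {m : ℕ} (hm : 2 ≤ m) :
    exp 1 * log m - 64 * exp 1 ^ 3 / log m ≤ extremalMin m := by
  have hm' : (2 : ℝ) ≤ m := by exact_mod_cast hm
  have hL : 0 < log (m : ℝ) := log_pos (by linarith)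
  have : Nonempty (Fin m) := ⟨⟨0, by omega⟩⟩
  refine le_csInf ⟨_, 1, fun _ => 0, fun _ => 0, le_rfl, by omega,
    fun u v huv => (huv (Subsingleton.elim u v)).elim, rfl⟩ ?_
  rintro _ ⟨k, α, β, -, -, hsc, rfl⟩
  refine le_csInf ⟨_, fun _ => 1, ⟨fun _ => one_pos, fun _ _ _ _ => by simp⟩, rfl⟩ ?_
  rintro _ ⟨x, ⟨hx, hu⟩, rfl⟩
  have h := sum_ge_of_unitCycleProducts hsc hx hu
  rw [Fintype.card_fin] at h
  rcases h with h | ⟨j, hj0, hj, h⟩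
  · have : 0 < 64 * exp 1 ^ 3 / log (m : ℝ) := by positivity
    linarith
  · exact log_sub_lower_bound hm' (Finset.sum_nonneg fun a _ => (hx a).le) hj0 hj h

/-- Asymptotics of the extremal minimum over strongly connected graphs:
`M(m) = e·ln m + O(1/ln m)`. -/
theorem extremalMin_asymptotics :
    ∃ C : ℝ, 0 < C ∧ ∀ m : ℕ, 2 ≤ m →
      |extremalMin m - Real.exp 1 * Real.log m| ≤ C / Real.log m := by
  refine ⟨64 * exp 1 ^ 3, by positivity, fun m hm => ?_⟩
  have hm' : (2 : ℝ) ≤ m := by exact_mod_cast hm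
  have hL : 0 < log (m : ℝ) := log_pos (by linarith)
  have hceil : ⌈log (m : ℝ)⌉₊ ≤ m :=
    Nat.ceil_le.2 (by linarith [log_le_sub_one_of_pos (by linarith : (0 : ℝ) < m)])
  have hupper := (extremalMin_le (Nat.ceil_pos.2 hL) hceil).trans (natCeil_mul_exp_le hL)
  have hC : exp 1 / log (m : ℝ) ≤ 64 * exp 1 ^ 3 / log m := by
    gcongr
    have he : 1 ≤ exp 1 := one_le_exp (by norm_num)
    nlinarith [pow_le_pow_right₀ he (by norm_num : 1 ≤ 3)]
  rw [abs_le]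
  constructor <;> linarith [le_extremalMin hm]
end

section
/- Analytic inequality underlying the logarithmic lower bound: for all real numbers r and x with r > 2 and 1 ≤ x ≤ r − 1, one has x · (r − x)^{1/x} > e · ln(r − ln r). -/
/-- The tangent line of `log` at `s` lies above the graph of `log`. -/
theorem log_le_tangent {a s : ℝ} (ha : 0 < a) (hs : 0 < s) :
    Real.log a ≤ Real.log s + a / s - 1 := by
  have h := Real.log_le_sub_one_of_pos (div_pos ha hs)
  rw [Real.log_div ha.ne' hs.ne'] at h
  linarith

theorem log_four_eq : Real.log 4 = 2 * Real.log 2 := by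
  rw [show (4 : ℝ) = 2 ^ 2 by norm_num, Real.log_pow]; norm_num

theorem log_three_halves_lt : Real.log (3 / 2) < 0.406 := by
  have h : Real.log ((3 / 2 : ℝ) ^ 41) ≤ Real.log (2 ^ 24) :=
    Real.log_le_log (by positivity) (by norm_num)
  rw [Real.log_pow, Real.log_pow] at h
  have := Real.log_two_lt_d9
  norm_num at h ⊢
  linarith

/-- A Padé-type lower bound for `log r - log (r - log r)`. -/
theorem two_mul_log_div_le_log_sub_log {r : ℝ} (hr : 2 < r) :
    2 * Real.log r / (2 * r - Real.log r) ≤ Real.log r - Real.log (r - Real.log r) := by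
  have hl : 0 < Real.log r := Real.log_pos (by linarith)
  have hM : 0 < r - Real.log r := by
    have := Real.log_le_sub_one_of_pos (show 0 < r by linarith)
    linarith
  have h := Real.le_log_one_add_of_nonneg (div_pos hl hM).le
  have e1 : 1 + Real.log r / (r - Real.log r) = r / (r - Real.log r) := by
    field_simp; ring
  have e2 : 2 * (Real.log r / (r - Real.log r)) / (Real.log r / (r - Real.log r) + 2)
      = 2 * Real.log r / (2 * r - Real.log r) := by
    have : 2 * r - Real.log r ≠ 0 := by linarith
    have h3 : Real.log r / (r - Real.log r) + 2 = (2 * r - Real.log r) / (r - Real.log r) := by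
      field_simp; ring
    rw [h3]; field_simp
  rw [e1, e2, Real.log_div (by linarith) hM.ne'] at h
  exact h

theorem exp_sub_one_mul_le {t : ℝ} (h0 : 0 ≤ t) (h1 : t ≤ 1) :
    (Real.exp t - 1 - t) * (6 - 2 * t) ≤ 3 * t ^ 2 := by
  have h := Real.exp_bound' h0 h1 (n := 4) (by norm_num)
  norm_num [Finset.sum_range_succ, Nat.factorial] at h
  have h2 : (Real.exp t - 1 - t) * (6 - 2 * t)
      ≤ (t ^ 2 / 2 + t ^ 3 / 6 + t ^ 4 * 5 / 96) * (6 - 2 * t) :=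
    mul_le_mul_of_nonneg_right (by linarith) (by linarith)
  have h4 : 0 ≤ t ^ 4 := by positivity
  have h5 : 0 ≤ t ^ 5 := by positivity
  nlinarith

theorem log_mul_exp_sub_one_lt {r : ℝ} (hr : 2 < r) (hM : 3 / 2 ≤ r - Real.log r) :
    Real.log (r - Real.log r) * (Real.exp (3 / (2 * (r - Real.log r))) - 1)
      < Real.log r * (3 / (2 * (r - Real.log r))) := by
  have hδ := two_mul_log_div_le_log_sub_log hr
  have hl : 0 < Real.log r := Real.log_pos (by linarith)
  have hlr : 5 * Real.log r < 2 * r + 2 := by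
    have := log_le_tangent (show 0 < r by linarith) (show (0 : ℝ) < 4 by norm_num)
    rw [log_four_eq] at this
    linarith [Real.log_two_lt_d9]
  have hc : 0 < Real.log (r - Real.log r) := Real.log_pos (by linarith)
  set l := Real.log r
  set c := Real.log (r - l)
  obtain ⟨M, hMd⟩ : ∃ M, M = r - l := ⟨_, rfl⟩
  rw [← hMd] at hM ⊢
  have ht1 : 3 / (2 * M) ≤ 1 := by rw [div_le_one (by linarith)]; linarith
  have ht0 : 0 < 3 / (2 * M) := by apply div_pos <;> linarith
  have hE := exp_sub_one_mul_le ht0.le ht1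
  set t := 3 / (2 * M) with ht
  have htM : t * M = 3 / 2 := by rw [ht]; field_simp
  rw [div_le_iff₀ (by linarith)] at hδ
  have key : 3 * t * c < (l - c) * (6 - 2 * t) := by
    have hd : 0 < l - c := by
      by_contra! h
      nlinarith [mul_nonneg_of_nonpos_of_nonpos h (show -(2 * r - l) ≤ 0 by linarith)]
    have k1 : 3 / 2 * c < (l - c) * (2 * M - 1) := by
      nlinarith [mul_pos hd (show 0 < 2 * r + 2 - 5 * l by linarith)]
    have k2 : 3 * t * c * M < (l - c) * (6 - 2 * t) * M := by
      linear_combination 3 * k1 + (3 * c + 2 * (l - c)) * htM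
    exact lt_of_mul_lt_mul_right k2 (by linarith)
  have h6 : 0 < 6 - 2 * t := by linarith
  have : c * (Real.exp t - 1 - t) * (6 - 2 * t) < (l - c) * t * (6 - 2 * t) := by
    nlinarith [mul_le_mul_of_nonneg_left hE hc.le, mul_lt_mul_of_pos_right key ht0]
  have := lt_of_mul_lt_mul_right this h6.le
  linarith

/-- The linear function `t ↦ log K + (r - K) * t` with `K = 2 / 3 * (r - log r)` exceeds
`t ↦ log (r - log r) * exp t` at `t = 1`. -/
theorem log_mul_exp_one_lt {r : ℝ} (hr : 2 < r) :
    Real.log (r - Real.log r) * Real.exp 1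
      < Real.log (2 / 3 * (r - Real.log r)) + (r - 2 / 3 * (r - Real.log r)) := by
  have hδ := two_mul_log_div_le_log_sub_log hr
  have hl : 0 < Real.log r := Real.log_pos (by linarith)
  have hM : 1 < r - Real.log r := by
    have := Real.log_lt_sub_one_of_pos (show 0 < r by linarith) (by linarith)
    linarith
  have hc : 0 < Real.log (r - Real.log r) := Real.log_pos hM
  have h32 := log_three_halves_lt
  have hK : Real.log (2 / 3 * (r - Real.log r))
      = Real.log (r - Real.log r) - Real.log (3 / 2) := by
    rw [← Real.log_div (by linarith) (by norm_num)]
    congr 1; ring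
  have he := Real.exp_one_lt_d9
  have h2 := Real.log_two_lt_d9
  have h2' := Real.log_two_gt_d9
  have hce : Real.log (r - Real.log r) * Real.exp 1 ≤ Real.log (r - Real.log r) * 2.7183 :=
    mul_le_mul_of_nonneg_left (by linarith) hc.le
  rw [hK]
  rcases le_or_gt r 7 with h7 | h7
  · have hlr : r / 4 ≤ Real.log r := by
      rcases le_or_gt r 4 with h4 | h4
      · have := log_le_tangent (show (0 : ℝ) < 2 by norm_num) (show 0 < r by linarith)
        have h : 2 / r ≤ 1 + Real.log 2 - r / 4 := by
          rw [div_le_iff₀ (by linarith)]; nlinarith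
        linarith
      · have := log_le_tangent (show (0 : ℝ) < 4 by norm_num) (show 0 < r by linarith)
        rw [log_four_eq] at this
        have h : 4 / r ≤ 1 + 2 * Real.log 2 - r / 4 := by
          rw [div_le_iff₀ (by linarith)]; nlinarith
        linarith
    have hδ' : 1 / 4 ≤ 2 * Real.log r / (2 * r - Real.log r) := by
      rw [le_div_iff₀ (by linarith)]; linarith
    have h216 : Real.log 2.16 ≤ Real.log 2 + 0.08 := by
      have := log_le_tangent (show (0 : ℝ) < 2.16 by norm_num) (show (0 : ℝ) < 2 by norm_num)
      norm_num at this ⊢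
      linarith
    have := log_le_tangent (show 0 < r - Real.log r by linarith) (show (0 : ℝ) < 2.16 by norm_num)
    norm_num at *
    linarith
  · have h8 := log_le_tangent (show 0 < r by linarith) (show (0 : ℝ) < 8 by norm_num)
    rw [show (8 : ℝ) = 2 ^ 3 by norm_num, Real.log_pow] at h8
    have := log_le_tangent (show 0 < r - Real.log r by linarith) (show (0 : ℝ) < 4 by norm_num)
    rw [log_four_eq] at this
    have hδ' : 0 ≤ 2 * Real.log r / (2 * r - Real.log r) := by
      apply div_nonneg <;> linarith
    norm_num at *
    linarith

/-- A multiple of `exp` lying strictly below a linear function at two points lies strictly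
below it in between. -/
theorem mul_exp_lt_of_mem_Icc {c p q a b t : ℝ} (hc : 0 ≤ c) (hat : a ≤ t) (htb : t ≤ b)
    (ha : c * Real.exp a < p + q * a) (hb : c * Real.exp b < p + q * b) :
    c * Real.exp t < p + q * t := by
  obtain ⟨u, v, hu, hv, huv, rfl⟩ : t ∈ segment ℝ a b := by
    rw [segment_eq_Icc (hat.trans htb)]; exact ⟨hat, htb⟩
  have h := convexOn_exp.2 (Set.mem_univ a) (Set.mem_univ b) hu hv huv
  simp only [smul_eq_mul] at h ⊢
  have h' := mul_le_mul_of_nonneg_left h hc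
  have e : p + q * (u * a + v * b) = u * (p + q * a) + v * (p + q * b) := by
    linear_combination (-p) * huv
  rw [e]
  rcases hu.eq_or_lt with rfl | hu'
  · have : v = 1 := by linarith
    subst this
    linarith
  · nlinarith [mul_lt_mul_of_pos_left ha hu', mul_le_mul_of_nonneg_left hb.le hv]

theorem mul_exp_sub_one_lt_of_le {c l s t : ℝ} (hc : 0 ≤ c) (ht : 0 < t) (hts : t ≤ s)
    (h : c * (Real.exp s - 1) < l * s) : c * (Real.exp t - 1) < l * t := by
  have hs : 0 < s := ht.trans_le hts
  have hcv := convexOn_exp.2 (Set.mem_univ 0) (Set.mem_univ s)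
    (show 0 ≤ 1 - t / s by rw [sub_nonneg, div_le_one hs]; exact hts)
    (div_pos ht hs).le (by ring)
  simp only [smul_eq_mul, mul_zero, zero_add, Real.exp_zero, div_mul_cancel₀ t hs.ne'] at hcv
  have h1 := mul_le_mul_of_nonneg_left hcv hc
  have h2 := mul_lt_mul_of_pos_left h (div_pos ht hs)
  have h3 : t / s * (l * s) = l * t := by field_simp
  linarith

theorem log_mul_exp_lt {r t : ℝ} (hr : 2 < r) (ht0 : 0 < t) (ht1 : t ≤ 1) :
    Real.log (r - Real.log r) * Real.exp t < r * t - 1 - Real.log t := by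
  have hl : 0 < Real.log r := Real.log_pos (by linarith)
  have hM : 1 < r - Real.log r := by
    have := Real.log_lt_sub_one_of_pos (show 0 < r by linarith) (by linarith)
    linarith
  have hc : 0 < Real.log (r - Real.log r) := Real.log_pos hM
  have tangent : ∀ K : ℝ, 0 < K → Real.log K + (r - K) * t ≤ r * t - 1 - Real.log t := by
    intro K hK
    have := Real.log_le_sub_one_of_pos (mul_pos hK ht0)
    rw [Real.log_mul hK.ne' ht0.ne'] at this
    linarith
  have small : ∀ s : ℝ, t ≤ s →
      Real.log (r - Real.log r) * (Real.exp s - 1) < Real.log r * s →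
      Real.log (r - Real.log r) * Real.exp t < r * t - 1 - Real.log t := by
    intro s hts hs
    have h1 := mul_exp_sub_one_lt_of_le hc.le ht0 hts hs
    have h2 := tangent (r - Real.log r) (by linarith)
    linarith
  rcases le_or_gt (3 / 2) (r - Real.log r) with hM2 | hM2
  · have hA := log_mul_exp_sub_one_lt hr hM2
    rcases le_or_gt t (3 / (2 * (r - Real.log r))) with hts | hts
    · exact small _ hts hA
    · refine lt_of_lt_of_le ?_ (tangent (2 / 3 * (r - Real.log r)) (by linarith))
      refine mul_exp_lt_of_mem_Icc hc.le hts.le ht1 ?_ ?_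
      · have hM0 : r - Real.log r ≠ 0 := by linarith
        have e1 : 2 / 3 * (r - Real.log r) * (3 / (2 * (r - Real.log r))) = 1 := by
          field_simp
        have e2 : (r - Real.log r) * (3 / (2 * (r - Real.log r))) = 3 / 2 := by
          field_simp
        have e3 : Real.log (2 / 3 * (r - Real.log r))
            = Real.log (r - Real.log r) - Real.log (3 / 2) := by
          rw [← Real.log_div (by linarith) (by norm_num)]
          congr 1; ring
        have h32 := log_three_halves_lt
        rw [e3]
        norm_num at h32
        linarith
      · rw [mul_one]
        exact log_mul_exp_one_lt hr
  · refine small 1 ht1 ?_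
    have hδ := two_mul_log_div_le_log_sub_log hr
    have hlr : Real.log r ≤ r / 2 := by
      have := log_le_tangent (show 0 < r by linarith) (show (0 : ℝ) < 2 by norm_num)
      linarith [Real.log_two_lt_d9]
    rw [div_le_iff₀ (by linarith)] at hδ
    have he := Real.exp_one_lt_d9
    have h1 : Real.log (r - Real.log r) * (Real.exp 1 - 1)
        ≤ Real.log (r - Real.log r) * 1.7183 :=
      mul_le_mul_of_nonneg_left (by linarith) hc.le
    have h2 : Real.log (r - Real.log r) * 1.7183 < Real.log r := by
      set l := Real.log r
      set c := Real.log (r - l)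
      by_contra! h
      have hd : l - c ≤ 0.7183 * c := by linarith
      nlinarith [mul_pos hl (show 0 < 4.5 - (2 * r - l) by linarith),
        mul_le_mul_of_nonneg_right (show 1.7183 * (l - c) ≤ 0.7183 * l by linarith)
          (show 0 ≤ 2 * r - l by linarith)]
    linarith

/-- Analytic inequality underlying the logarithmic lower bound: for `r > 2`
and `1 ≤ x ≤ r - 1`, one has `x·(r-x)^(1/x) > e·ln(r - ln r)`. -/
theorem analytic_log_lower_bound (r x : ℝ) (hr : 2 < r)
    (hx1 : 1 ≤ x) (hx2 : x ≤ r - 1) :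
    x * (r - x) ^ (1 / x) > Real.exp 1 * Real.log (r - Real.log r) := by
  have hM : 1 < r - Real.log r := by
    have := Real.log_lt_sub_one_of_pos (show 0 < r by linarith) (by linarith)
    linarith
  have hc : 0 < Real.log (r - Real.log r) := Real.log_pos hM
  have hx : 0 < x := by linarith
  have hy : 0 < r - x := by linarith
  have hG := log_mul_exp_lt hr (inv_pos.2 hy) (inv_le_one_of_one_le₀ (by linarith))
  rw [Real.log_inv] at hG
  have hyt : (r - x) * (r - x)⁻¹ = 1 := mul_inv_cancel₀ hy.ne'
  set c := Real.log (r - Real.log r)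
  have hce : 0 < c * Real.exp (r - x)⁻¹ := by positivity
  have h1 := Real.log_le_sub_one_of_pos (div_pos hce hx)
  rw [Real.log_div hce.ne' hx.ne', Real.log_mul hc.ne' (Real.exp_pos _).ne', Real.log_exp] at h1
  have h2 := mul_le_mul_of_nonneg_left h1 hx.le
  have h3 : x * (c * Real.exp (r - x)⁻¹ / x - 1) = c * Real.exp (r - x)⁻¹ - x := by
    field_simp
  have h4 : x * (1 + Real.log c - Real.log x) < Real.log (r - x) := by linarith
  have h5 : 1 + Real.log c < Real.log x + 1 / x * Real.log (r - x) := by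
    have : 1 + Real.log c - Real.log x < Real.log (r - x) / x := by
      rw [lt_div_iff₀ hx]; linarith
    rw [one_div_mul_eq_div]; linarith
  have hp : 0 < (r - x) ^ (1 / x) := Real.rpow_pos_of_pos hy _
  refine (Real.log_lt_log_iff (by positivity) (by positivity)).1 ?_
  rw [Real.log_mul (Real.exp_pos 1).ne' hc.ne', Real.log_exp, Real.log_mul hx.ne' hp.ne',
    Real.log_rpow hy]
  exact h5
end

section
/- Lower bound for irreducible assignments: let n ≥ 1 and let ω assign to each i ∈ {1,…,n} a nonempty subset ω(i) ⊆ {1,…,n}. Suppose ω is irreducible: there is no nonempty proper subset Σ ⊊ {1,…,n} such that ω(i) ⊆ Σ for every i ∈ Σ. Then for every x ∈ ℝ^n with all components x_i > 0, ∑_{i=1}^n x_i / min{ x_j : j ∈ ω(i) } ≥ e · ln(n − ln n). -/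
/-- The tangent line inequality for `exp` at `σ`, read at `log r`. -/
lemma exp_mul_one_sub_add_log_le {r : ℝ} (hr : 0 < r) (σ : ℝ) :
    Real.exp σ * (1 - σ + Real.log r) ≤ r := by
  have h := Real.add_one_le_exp (Real.log r - σ)
  have h2 : Real.exp σ * Real.exp (Real.log r - σ) = r := by
    rw [← Real.exp_add, add_sub_cancel, Real.exp_log hr]
  calc
    _ ≤ Real.exp σ * Real.exp (Real.log r - σ) := by gcongr; linarith
    _ = r := h2

lemma one_sub_mul_exp_le {u : ℝ} (h0 : 0 ≤ u) (h1 : u ≤ 1) :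
    (1 - u) * Real.exp u ≤ 1 - u ^ 2 / 2 := by
  have h := Real.exp_bound' h0 h1 (n := 3) (by norm_num)
  norm_num [Finset.sum_range_succ, Nat.factorial] at h
  have h2 := mul_le_mul_of_nonneg_left h (sub_nonneg.2 h1)
  have h3 : 0 ≤ u ^ 3 := by positivity
  have h4 : 0 ≤ u ^ 4 := by positivity
  nlinarith

lemma exp_one_mul_log_three_halves_le : Real.exp 1 * Real.log (3 / 2) ≤ 1.12 := by
  have h1 : 2 * Real.log (3 / 2) = Real.log 2 + Real.log (9 / 8) := by
    rw [← Real.log_mul (by norm_num) (by norm_num), ← Real.log_rpow (by norm_num)]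
    norm_num
  have h2 : Real.log (9 / 8) ≤ 9 / 8 - 1 := Real.log_le_sub_one_of_pos (by norm_num)
  have h3 := Real.log_two_lt_d9
  have h4 := Real.exp_one_lt_d9
  have h5 := Real.exp_pos 1
  nlinarith

/-- If `T` dominates all the tangent bounds for the sum of `m` positive numbers with product
`n + 1 - m`, then `T` is at least `e · log (n - log n)`. -/
lemma exp_one_mul_log_sub_log_le {n : ℕ} (hn : 1 ≤ n) {m T : ℝ} (hm : 1 ≤ m)
    (hp : 1 ≤ n + 1 - m)
    (hT : ∀ σ : ℝ, Real.exp σ * (m * (1 - σ) + Real.log (n + 1 - m)) ≤ T) :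
    Real.exp 1 * Real.log ((n : ℝ) - Real.log n) ≤ T := by
  have hlogp : 0 ≤ Real.log (n + 1 - m) := Real.log_nonneg hp
  have hmT : m ≤ T := by
    have := hT 0
    simp only [Real.exp_zero] at this
    linarith
  obtain rfl | hn2 : n = 1 ∨ 2 ≤ n := by omega
  · simp
    linarith
  have hn' : (2 : ℝ) ≤ n := by exact_mod_cast hn2
  set L := Real.log n with hL
  set p : ℝ := n + 1 - m with hpdef
  have hL2 : 0.69 ≤ L := by
    have h1 : Real.log 2 ≤ L := Real.log_le_log (by norm_num) hn'
    have h2 := Real.log_two_gt_d9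
    linarith
  have hz1 : 1 ≤ n - L := by
    have := Real.log_le_sub_one_of_pos (show (0 : ℝ) < n by linarith)
    linarith
  set A := Real.log (n - L) with hA
  have hA0 : 0 ≤ A := Real.log_nonneg hz1
  have hAL : A ≤ L := Real.log_le_log (by linarith) (by linarith)
  rcases le_or_gt m (1 + L) with hmL | hmL
  · have h := hT 1
    have h2 : A ≤ Real.log p := Real.log_le_log (by linarith) (by linarith)
    have h3 : Real.exp 1 * A ≤ Real.exp 1 * Real.log p := by gcongr
    simp only [sub_self, mul_zero, zero_add] at h
    linarith
  rcases le_or_gt m (2 * p) with hm2 | hm2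
  · have hm0 : 0 < m := by linarith
    have hp0 : 0 < p := by linarith
    set d := m - 1 - L with hd
    set u := 1 - A / m with hu
    have hum : u * m = m - A := by rw [hu]; field_simp
    have hu0 : 0 ≤ u := by
      rw [hu, sub_nonneg, div_le_one hm0]
      linarith
    have hu1 : u ≤ 1 := by
      have : 0 ≤ A / m := by positivity
      linarith
    have hlog : A - Real.log p ≤ d / p := by
      rw [hA, ← Real.log_div (by linarith) hp0.ne']
      have h := Real.log_le_sub_one_of_pos (show 0 < (n - L) / p by
        apply div_pos <;> linarith)
      have h2 : (n - L) / p - 1 = d / p := by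
        rw [div_sub_one hp0.ne']
        congr 1
        linarith
      linarith
    have hd2 : d / p ≤ m * (u ^ 2 / 2) := by
      rw [div_le_iff₀ hp0]
      have h4 : 4 * d ≤ (u * m) ^ 2 := by
        rw [hum]
        nlinarith [sq_nonneg (d - 1)]
      have h5 : d * m ≤ (m * (u ^ 2 / 2) * p) * m := by
        nlinarith [sq_nonneg (u * m)]
      exact le_of_mul_le_mul_right h5 hm0
    have hu2 := one_sub_mul_exp_le hu0 hu1
    have hT' := hT (1 - u)
    have hexp : Real.exp (1 - u) * Real.exp u = Real.exp 1 := by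
      rw [← Real.exp_add, sub_add_cancel]
    calc Real.exp 1 * A = Real.exp (1 - u) * (m * ((1 - u) * Real.exp u)) := by
          rw [← hexp, show A = m * (1 - u) by linarith]
          ring
      _ ≤ Real.exp (1 - u) * (m * (1 - u ^ 2 / 2)) := by gcongr
      _ ≤ Real.exp (1 - u) * (m * (1 - (1 - u)) + Real.log p) := by
          gcongr
          linarith
      _ ≤ T := hT'
  · have h1 := exp_mul_one_sub_add_log_le (show 0 < (n - L) / (3 / 2) by linarith) 1
    rw [Real.log_div (by linarith) (by norm_num)] at h1
    have h2 := exp_one_mul_log_three_halves_le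
    linarith

/-- In an irreducible assignment every vertex `v` is reached from `a` by a path avoiding `v`
before its end; `S` is the set of sources of the edges of this path. -/
lemma exists_path_sources {α : Type*} [Fintype α] [DecidableEq α] (ω : α → Finset α)
    (hirr : ¬ ∃ S : Finset α, S.Nonempty ∧ S ≠ Finset.univ ∧ ∀ i ∈ S, ω i ⊆ S)
    (f w : α → ℝ) (hw : ∀ i, ∀ j ∈ ω i, f i - f j ≤ w i) (a v : α) :
    ∃ S : Finset α, v ∉ S ∧ f a - f v ≤ ∑ i ∈ S, w i := by
  let P : Finset α → Prop := fun U ↦ a ∈ U ∧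
    ∀ v ∈ U, ∃ S ⊆ U, v ∉ S ∧ f a - f v ≤ ∑ i ∈ S, w i
  obtain ⟨U, hU⟩ := Set.Finite.exists_maximal (Set.toFinite {U | P U})
    ⟨{a}, by simp, fun v hv ↦ ⟨∅, by simp, by simp, by simp [Finset.mem_singleton.1 hv]⟩⟩
  obtain ⟨haU, hpath⟩ := hU.prop
  suffices hUniv : U = Finset.univ by
    obtain ⟨S, -, h⟩ := hpath v (hUniv ▸ Finset.mem_univ v)
    exact ⟨S, h⟩
  by_contra hne
  push Not at hirr
  obtain ⟨i, hi, hsub⟩ := hirr U ⟨a, haU⟩ hne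
  obtain ⟨j, hj, hjU⟩ := Finset.not_subset.1 hsub
  have hins : P (insert j U) := by
    refine ⟨Finset.mem_insert_of_mem haU, fun v hv ↦ ?_⟩
    rcases Finset.mem_insert.1 hv with rfl | hv
    · obtain ⟨S, hSU, hiS, hS⟩ := hpath i hi
      have hsub' : insert i S ⊆ U := Finset.insert_subset hi hSU
      refine ⟨insert i S, hsub'.trans (Finset.subset_insert _ _), fun h ↦ hjU (hsub' h), ?_⟩
      rw [Finset.sum_insert hiS]
      linarith [hw i v hj]
    · obtain ⟨S, hSU, h⟩ := hpath v hv
      exact ⟨S, hSU.trans (Finset.subset_insert _ _), h⟩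
  exact hjU (hU.le_of_ge hins (Finset.subset_insert _ _) (Finset.mem_insert_self _ _))


/-- Lower bound for irreducible assignments: if `ω` assigns a nonempty subset
of `{1,…,n}` to each index and is irreducible (no nonempty proper subset `S`
satisfies `ω(i) ⊆ S` for all `i ∈ S`), then for positive `x`,
`∑ᵢ xᵢ / min{xⱼ : j ∈ ω(i)} ≥ e · ln(n - ln n)`. -/
theorem irreducible_assignment_lower_bound
    (n : ℕ) (hn : 1 ≤ n)
    (ω : Fin n → Finset (Fin n)) (hne : ∀ i, (ω i).Nonempty)
    (hirr : ¬ ∃ S : Finset (Fin n), S.Nonempty ∧ S ≠ Finset.univ ∧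
      ∀ i ∈ S, ω i ⊆ S)
    (x : Fin n → ℝ) (hx : ∀ i, 0 < x i) :
    ∑ i, x i / ((ω i).inf' (hne i) x) ≥
      Real.exp 1 * Real.log ((n : ℝ) - Real.log n) := by
  have : Nonempty (Fin n) := ⟨⟨0, hn⟩⟩
  obtain ⟨a, ha⟩ := Finite.exists_max x
  obtain ⟨b, hb⟩ := Finite.exists_min x
  set r : Fin n → ℝ := fun i ↦ x i / (ω i).inf' (hne i) x with hr
  have hinf : ∀ i, 0 < (ω i).inf' (hne i) x := fun i ↦
    (Finset.lt_inf'_iff _).2 fun j _ ↦ hx j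
  have hr0 : ∀ i, 0 < r i := fun i ↦ div_pos (hx i) (hinf i)
  have hrb : ∀ i, x b / x a ≤ r i := fun i ↦ by
    obtain ⟨j, hj⟩ := hne i
    exact div_le_div₀ (hx i).le (hb i) (hinf i) ((Finset.inf'_le x hj).trans (ha j))
  obtain ⟨S, hbS, hS⟩ := exists_path_sources ω hirr (fun i ↦ Real.log (x i))
    (fun i ↦ Real.log (r i)) (fun i j hj ↦ by
      rw [← Real.log_div (hx i).ne' (hx j).ne']
      exact Real.log_le_log (div_pos (hx i) (hx j))
        (div_le_div_of_nonneg_left (hx i).le (hinf i) (Finset.inf'_le x hj))) a b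
  have hcard : S.card + 1 ≤ n := by
    rw [← Finset.card_insert_of_notMem hbS]
    simpa using Finset.card_le_univ (insert b S)
  have hcard' : (S.card : ℝ) + 1 ≤ n := by exact_mod_cast hcard
  have hp : (0 : ℝ) < n - S.card := by linarith
  refine exp_one_mul_log_sub_log_le hn (m := S.card + 1) (by simp) (by linarith) fun σ ↦ ?_
  have hpath : Real.exp σ * (S.card * (1 - σ) + (Real.log (x a) - Real.log (x b))) ≤
      ∑ i ∈ S, r i := calc
    _ ≤ Real.exp σ * (S.card * (1 - σ) + ∑ i ∈ S, Real.log (r i)) := by gcongr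
    _ = ∑ i ∈ S, Real.exp σ * (1 - σ + Real.log (r i)) := by
      rw [← Finset.mul_sum, Finset.sum_add_distrib, Finset.sum_const, nsmul_eq_mul]
    _ ≤ _ := Finset.sum_le_sum fun i _ ↦ exp_mul_one_sub_add_log_le (hr0 i) σ
  have hrest : (n - S.card) * (x b / x a) ≤ ∑ i ∈ Sᶜ, r i := by
    have h := Finset.card_nsmul_le_sum Sᶜ r _ fun i _ ↦ hrb i
    rwa [nsmul_eq_mul, Finset.card_compl, Fintype.card_fin, Nat.cast_sub (by omega)] at h
  have htan := exp_mul_one_sub_add_log_le (mul_pos hp (div_pos (hx b) (hx a))) σ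
  rw [Real.log_mul hp.ne' (div_pos (hx b) (hx a)).ne',
    Real.log_div (hx b).ne' (hx a).ne'] at htan
  rw [← Finset.sum_add_sum_compl S, add_sub_add_right_eq_sub]
  linarith
end

section
/- Linear asymptotics of Shallit's minimum: for each integer n ≥ 1 and each x ∈ ℝ^n with all components positive, let S_n(x) = ∑_{i=1}^n x_i + ∑_{1 ≤ i ≤ j ≤ n} ∏_{k=i}^j (1/x_k), and let M_n = inf { S_n(x) : x ∈ ℝ^n, x_i > 0 for all i }. Then lim_{n→∞} M_n/n = 3. -/
/-- Shallit's sum `S_n(x) = ∑ᵢ xᵢ + ∑_{1 ≤ i ≤ j ≤ n} ∏_{k=i}^j 1/x_k`. -/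
noncomputable def shallitSum (n : ℕ) (x : Fin n → ℝ) : ℝ :=
  (∑ i, x i) +
    ∑ i : Fin n, ∑ j : Fin n,
      if i ≤ j then ∏ k ∈ Finset.Icc i j, (x k)⁻¹ else 0

/-- The minimum of Shallit's sum over positive vectors. -/
noncomputable def shallitMin (n : ℕ) : ℝ :=
  sInf {s | ∃ x : Fin n → ℝ, (∀ i, 0 < x i) ∧ s = shallitSum n x}

/-- The sum of all products of reciprocals over blocks of indices that end at the last index. -/
noncomputable def shallitTail (n : ℕ) (x : Fin n → ℝ) : ℝ :=
  ∑ i, ∏ k ∈ Finset.Ici i, (x k)⁻¹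

theorem shallitTail_zero (x : Fin 0 → ℝ) : shallitTail 0 x = 0 := by
  simp [shallitTail]

theorem shallitSum_zero (x : Fin 0 → ℝ) : shallitSum 0 x = 0 := by
  simp [shallitSum]

theorem Fin.prod_Ici_castSucc {M : Type*} [CommMonoid M] {n : ℕ} (f : Fin (n + 1) → M)
    (i : Fin n) :
    ∏ k ∈ Finset.Ici i.castSucc, f k =
      (∏ k ∈ Finset.Ici i, f k.castSucc) * f (Fin.last n) := by
  rw [← Finset.filter_le_eq_Ici, ← Finset.filter_le_eq_Ici, Finset.prod_filter,
    Finset.prod_filter, Fin.prod_univ_castSucc]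
  simp [Fin.le_last]

theorem shallitTail_succ (n : ℕ) (x : Fin (n + 1) → ℝ) :
    shallitTail (n + 1) x =
      (1 + shallitTail n fun i => x i.castSucc) * (x (Fin.last n))⁻¹ := by
  have h : Finset.Ici (Fin.last n) = {Fin.last n} := by
    ext k
    simp [Fin.last_le_iff]
  simp only [shallitTail, Fin.sum_univ_castSucc, Fin.prod_Ici_castSucc, h,
    Finset.prod_singleton, ← Finset.sum_mul]
  ring

theorem shallitSum_succ (n : ℕ) (x : Fin (n + 1) → ℝ) :
    shallitSum (n + 1) x =
      (shallitSum n fun i => x i.castSucc) + x (Fin.last n) + shallitTail (n + 1) x := by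
  have h (i : Fin (n + 1)) : Finset.Icc i (Fin.last n) = Finset.Ici i := by
    ext k
    simp [Fin.le_last]
  have h_row : ∑ j : Fin n, (if Fin.last n ≤ j.castSucc then
      ∏ k ∈ Finset.Icc (Fin.last n) j.castSucc, (x k)⁻¹ else 0) = 0 :=
    Finset.sum_eq_zero fun j _ => if_neg (not_le.2 (Fin.castSucc_lt_last j))
  simp only [shallitSum, shallitTail]
  rw [Fin.sum_univ_castSucc (fun i => x i)]
  simp only [Fin.sum_univ_castSucc (n := n), h_row, Fin.le_last, if_true, h,
    Fin.castSucc_le_castSucc_iff, Fin.prod_Icc_castSucc, Finset.sum_add_distrib]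
  ring

theorem shallitTail_succ_pos (n : ℕ) (x : Fin (n + 1) → ℝ) (hx : ∀ i, 0 < x i) :
    0 < shallitTail (n + 1) x :=
  Finset.sum_pos (fun _ _ => Finset.prod_pos fun k _ => inv_pos.2 (hx k)) Finset.univ_nonempty

theorem two_le_add_inv {t : ℝ} (ht : 0 < t) : 2 ≤ t + t⁻¹ := by
  have h : t + t⁻¹ - 2 = (t - 1) ^ 2 * t⁻¹ := by
    field_simp
    ring
  have : 0 ≤ (t - 1) ^ 2 * t⁻¹ := by positivity
  linarith

theorem one_add_log_sub_log_le {u t : ℝ} (hu : 0 < u) (ht : 0 < t) :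
    1 + Real.log u - Real.log t ≤ u * t⁻¹ := by
  have h := Real.log_le_sub_one_of_pos (mul_pos hu (inv_pos.2 ht))
  rw [Real.log_mul hu.ne' (inv_pos.2 ht).ne', Real.log_inv] at h
  linarith

theorem last_eq_shallitTail_mul_inv (n : ℕ) (x : Fin (n + 1) → ℝ) (hx : ∀ i, 0 < x i) :
    x (Fin.last n) =
      (1 + shallitTail n fun i => x i.castSucc) * (shallitTail (n + 1) x)⁻¹ := by
  have ht := shallitTail_succ_pos n x hx
  rw [eq_mul_inv_iff_mul_eq₀ ht.ne', shallitTail_succ]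
  have := (hx (Fin.last n)).ne'
  field_simp

theorem le_shallitSum_add_log (n : ℕ) (x : Fin (n + 1) → ℝ) (hx : ∀ i, 0 < x i) :
    3 * (n : ℝ) + 1 ≤ shallitSum (n + 1) x + Real.log (shallitTail (n + 1) x) := by
  induction n with
  | zero =>
    have ht := shallitTail_succ_pos 0 x hx
    rw [shallitSum_succ, last_eq_shallitTail_mul_inv 0 x hx, shallitSum_zero, shallitTail_zero]
    have := one_add_log_sub_log_le one_pos ht
    rw [Real.log_one] at this
    norm_num at this ⊢
    linarith
  | succ n ih =>
    have ih := ih (fun i => x i.castSucc) fun i => hx _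
    have hu := shallitTail_succ_pos n (fun i => x i.castSucc) fun i => hx _
    have ht := shallitTail_succ_pos (n + 1) x hx
    rw [shallitSum_succ, last_eq_shallitTail_mul_inv (n + 1) x hx]
    have h_log := one_add_log_sub_log_le hu ht
    have h_inv := two_le_add_inv ht
    push_cast
    linarith

theorem three_mul_sub_three_le_shallitSum (n : ℕ) (x : Fin n → ℝ) (hx : ∀ i, 0 < x i) :
    3 * (n : ℝ) - 3 ≤ shallitSum n x := by
  match n with
  | 0 => simp [shallitSum_zero]
  | 1 =>
    have ht := shallitTail_succ_pos 0 x hx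
    have h_last := hx (Fin.last 0)
    rw [shallitSum_succ, shallitSum_zero]
    norm_num at h_last ⊢
    linarith
  | n + 2 =>
    have h_sum := le_shallitSum_add_log n (fun i => x i.castSucc) fun i => hx _
    have hu := shallitTail_succ_pos n (fun i => x i.castSucc) fun i => hx _
    have ht := shallitTail_succ_pos (n + 1) x hx
    rw [shallitSum_succ, last_eq_shallitTail_mul_inv (n + 1) x hx]
    have h_log := one_add_log_sub_log_le hu ht
    have h_tail := Real.log_le_sub_one_of_pos ht
    have h_inv := inv_pos.2 ht
    push_cast
    linarith

theorem shallitTail_two_le_one (n : ℕ) : shallitTail n (fun _ => 2) ≤ 1 := by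
  induction n with
  | zero => simp [shallitTail_zero]
  | succ n ih =>
    rw [shallitTail_succ]
    linarith

theorem shallitSum_two_le (n : ℕ) : shallitSum n (fun _ => 2) ≤ 3 * n := by
  induction n with
  | zero => simp [shallitSum_zero]
  | succ n ih =>
    rw [shallitSum_succ]
    have := shallitTail_two_le_one (n + 1)
    push_cast
    linarith

theorem three_mul_sub_three_le_shallitMin (n : ℕ) : 3 * (n : ℝ) - 3 ≤ shallitMin n := by
  refine le_csInf ⟨_, fun _ => 2, fun _ => two_pos, rfl⟩ ?_
  rintro s ⟨x, hx, rfl⟩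
  exact three_mul_sub_three_le_shallitSum n x hx

theorem shallitMin_le_three_mul (n : ℕ) : shallitMin n ≤ 3 * n := by
  have h_bdd : BddBelow {s | ∃ x : Fin n → ℝ, (∀ i, 0 < x i) ∧ s = shallitSum n x} := by
    refine ⟨3 * (n : ℝ) - 3, ?_⟩
    rintro s ⟨x, hx, rfl⟩
    exact three_mul_sub_three_le_shallitSum n x hx
  exact (csInf_le h_bdd ⟨fun _ => 2, fun _ => two_pos, rfl⟩).trans (shallitSum_two_le n)

/-- Linear asymptotics of Shallit's minimum: `lim_{n→∞} M_n / n = 3`. -/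
theorem shallitMin_linear_asymptotics :
    Filter.Tendsto (fun n : ℕ => shallitMin n / n) Filter.atTop (nhds 3) := by
  have h_lower : Filter.Tendsto (fun n : ℕ => 3 - 3 / (n : ℝ)) Filter.atTop (nhds 3) := by
    simpa using (tendsto_const_nhds (x := (3 : ℝ))).sub (tendsto_const_div_atTop_nhds_zero_nat 3)
  refine tendsto_of_tendsto_of_tendsto_of_le_of_le' h_lower tendsto_const_nhds ?_ ?_
  all_goals
    filter_upwards [Filter.eventually_gt_atTop 0] with n hn
    have hn : (0 : ℝ) < n := Nat.cast_pos.2 hn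
  · rw [le_div_iff₀ hn, sub_mul, div_mul_cancel₀ _ hn.ne']
    exact three_mul_sub_three_le_shallitMin n
  · rw [div_le_iff₀ hn]
    exact shallitMin_le_three_mul n
end

section
/- Crude asymptotics of the generalized Shallit problem: let P be a nonempty set of nonnegative integers containing at least one positive integer. Then the equation ρ = ∑_{m ∈ P} (m+1)·ρ^{−m−1} has a unique root ρ_P in the interval (1, ∞) (the series converging for every ρ > 1), and, with λ_P := ρ_P + ∑_{m ∈ P} ρ_P^{−m−1} = ∑_{m ∈ P} (m+2)·ρ_P^{−m−1}, one has lim_{n→∞} m_n(P)/n = λ_P, where m_n(P) = inf { S_n(x | P) : x ∈ ℝ^n, x_i > 0 for all i } and S_n(x | P) = ∑_{i=1}^n x_i + ∑_{(i,j) : 1 ≤ i ≤ j ≤ n, j−i ∈ P} ∏_{k=i}^j (1/x_k). -/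
open scoped Classical

/-- Generalized Shallit sum for a pattern `P ⊆ ℕ`:
`S_n(x|P) = ∑ᵢ xᵢ + ∑_{i ≤ j, j-i ∈ P} ∏_{k=i}^j 1/x_k`. -/
noncomputable def genShallitSum (P : Set ℕ) (n : ℕ) (x : Fin n → ℝ) : ℝ :=
  (∑ i, x i) +
    ∑ i : Fin n, ∑ j : Fin n,
      if i ≤ j ∧ (j.val - i.val) ∈ P then ∏ k ∈ Finset.Icc i j, (x k)⁻¹ else 0

/-- The minimum of the generalized Shallit sum over positive vectors. -/
noncomputable def genShallitMin (P : Set ℕ) (n : ℕ) : ℝ :=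
  sInf {s | ∃ x : Fin n → ℝ, (∀ i, 0 < x i) ∧ s = genShallitSum P n x}

open Finset in
theorem sum_fin_pairs_eq_sum_diff (n : ℕ) (F : ℕ → ℕ → ℝ) :
    (∑ i : Fin n, ∑ j : Fin n, if i ≤ j then F i.val (j.val - i.val) else 0) =
      ∑ m ∈ range n, ∑ i ∈ range (n - m), F i m := by
  have inner : ∀ i : ℕ, (∑ j ∈ range n, if i ≤ j then F i (j - i) else 0) =
      ∑ m ∈ range (n - i), F i m := by
    intro i
    rw [← Finset.sum_filter]
    have : (range n).filter (fun j => i ≤ j) = Ico i n := by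
      ext j; simp [and_comm]
    rw [this, Finset.sum_Ico_eq_sum_range]
    simp
  calc _ = ∑ i ∈ range n, ∑ j ∈ range n, if i ≤ j then F i (j - i) else 0 := by
        rw [← Fin.sum_univ_eq_sum_range
          (fun i => ∑ j ∈ range n, if i ≤ j then F i (j - i) else 0) n]
        refine Finset.sum_congr rfl fun i _ => ?_
        rw [← Fin.sum_univ_eq_sum_range (fun j => if i.val ≤ j then F i (j - i) else 0) n]
        rfl
    _ = _ := by
        rw [Finset.sum_congr rfl fun i _ => inner i]
        refine Finset.sum_comm' ?_
        intro i m
        simp only [mem_range]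
        omega

/-- The indicator of the pattern `P` with real values. -/
noncomputable def patternInd (P : Set ℕ) (m : ℕ) : ℝ := if m ∈ P then 1 else 0

theorem patternInd_nonneg (P : Set ℕ) (m : ℕ) : 0 ≤ patternInd P m := by
  unfold patternInd; split_ifs <;> norm_num

theorem patternInd_le_one (P : Set ℕ) (m : ℕ) : patternInd P m ≤ 1 := by
  unfold patternInd; split_ifs <;> norm_num

theorem patternInd_of_mem {P : Set ℕ} {m : ℕ} (h : m ∈ P) : patternInd P m = 1 := if_pos h

theorem genShallitSum_eq (P : Set ℕ) (n : ℕ) (x : Fin n → ℝ) :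
    genShallitSum P n x = (∑ i, x i) + ∑ i : Fin n, ∑ j : Fin n,
      if i ≤ j then patternInd P (j.val - i.val) * ∏ k ∈ Finset.Icc i j, (x k)⁻¹ else 0 := by
  unfold genShallitSum patternInd
  congr 1
  refine Finset.sum_congr rfl fun i _ => Finset.sum_congr rfl fun j _ => ?_
  by_cases h : i ≤ j <;> by_cases h' : (j.val - i.val) ∈ P <;> simp [h, h']

theorem tsum_pattern (P : Set ℕ) (f : ℕ → ℝ) (ρ : ℝ) :
    ∑' m : P, f m * ρ ^ (-((m : ℕ) : ℤ) - 1) =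
      ∑' m : ℕ, patternInd P m * (f m * ρ⁻¹ ^ (m + 1)) := by
  have key : ∀ m : ℕ, ρ ^ (-(m : ℤ) - 1) = ρ⁻¹ ^ (m + 1) := by
    intro m
    rw [inv_pow, ← zpow_natCast, ← zpow_neg]
    congr 1
    push_cast
    ring
  rw [tsum_congr fun m : P => by rw [key m],
    tsum_subtype P (fun m => f m * ρ⁻¹ ^ (m + 1))]
  refine tsum_congr fun m => ?_
  by_cases h : m ∈ P <;> simp [patternInd, h]

theorem summable_patternInd_mul (P : Set ℕ) {f : ℕ → ℝ} (hf : Summable f) (h0 : ∀ m, 0 ≤ f m) :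
    Summable fun m => patternInd P m * f m :=
  hf.of_nonneg_of_le (fun m => mul_nonneg (patternInd_nonneg P m) (h0 m))
    fun m => mul_le_of_le_one_left (h0 m) (patternInd_le_one P m)

theorem summable_pow_mul_pow_succ (k : ℕ) {q : ℝ} (h0 : 0 ≤ q) (h1 : q < 1) :
    Summable fun m : ℕ => (m : ℝ) ^ k * q ^ (m + 1) := by
  have h : ‖q‖ < 1 := by rwa [Real.norm_of_nonneg h0]
  refine ((summable_pow_mul_geometric_of_norm_lt_one k h).mul_right q).congr fun m => ?_
  ring

theorem summable_succ_mul_pow {q : ℝ} (h0 : 0 ≤ q) (h1 : q < 1) :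
    Summable fun m : ℕ => ((m : ℝ) + 1) * q ^ (m + 1) := by
  refine ((summable_pow_mul_pow_succ 1 h0 h1).add (summable_pow_mul_pow_succ 0 h0 h1)).congr
    fun m => ?_
  ring

/-- The right-hand side of the characteristic equation, as a function of `q = ρ⁻¹`. -/
noncomputable def patternSeries (P : Set ℕ) (q : ℝ) : ℝ :=
  ∑' m : ℕ, patternInd P m * (((m : ℝ) + 1) * q ^ (m + 1))

theorem summable_patternSeries (P : Set ℕ) {q : ℝ} (h0 : 0 ≤ q) (h1 : q < 1) :
    Summable fun m : ℕ => patternInd P m * (((m : ℝ) + 1) * q ^ (m + 1)) :=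
  summable_patternInd_mul P (summable_succ_mul_pow h0 h1) fun m => by positivity

theorem patternSeries_mono (P : Set ℕ) {q r : ℝ} (h0 : 0 ≤ q) (hqr : q ≤ r) (h1 : r < 1) :
    patternSeries P q ≤ patternSeries P r := by
  refine (summable_patternSeries P h0 (hqr.trans_lt h1)).tsum_le_tsum ?_
    (summable_patternSeries P (h0.trans hqr) h1)
  intro m
  have := patternInd_nonneg P m
  gcongr

theorem continuousOn_patternSeries (P : Set ℕ) {r : ℝ} (h0 : 0 ≤ r) (h1 : r < 1) :
    ContinuousOn (patternSeries P) (Set.Icc 0 r) := by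
  refine continuousOn_tsum (fun m => by fun_prop) (summable_patternSeries P h0 h1) ?_
  intro m q hq
  have h2 := patternInd_nonneg P m
  have h3 := hq.1
  have h4 := hq.2
  rw [Real.norm_of_nonneg (by positivity)]
  gcongr

theorem exists_mul_patternSeries_eq_one {P : Set ℕ} (hpos : ∃ m ∈ P, 0 < m) :
    ∃ q : ℝ, 0 < q ∧ q < 1 ∧ q * patternSeries P q = 1 := by
  obtain ⟨a, ha, ha0⟩ := hpos
  set N : ℝ := (a : ℝ) + 2 with hN
  have hNpos : 0 < N := by positivity
  have hN2 : 2 ≤ N := by simp [hN]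
  set r : ℝ := 1 - 1 / (2 * N) with hr
  have hd : 0 < 1 / (2 * N) := by positivity
  have hd1 : 1 / (2 * N) ≤ 1 / 4 := by
    apply one_div_le_one_div_of_le <;> linarith
  have hr0 : 0 ≤ r := by linarith
  have hr1 : r < 1 := by linarith
  have hbern : 1 / 2 ≤ r ^ (a + 2) := by
    have h := one_add_mul_le_pow (a := -(1 / (2 * N))) (by linarith) (a + 2)
    have h2 : 1 + ((a + 2 : ℕ) : ℝ) * -(1 / (2 * N)) = 1 / 2 := by
      push_cast
      rw [← hN]
      field_simp
      norm_num
    rw [h2] at h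
    simpa [hr, sub_eq_add_neg] using h
  have hge : 1 ≤ r * patternSeries P r := by
    have h1 := (summable_patternSeries P hr0 hr1).le_tsum a fun m _ =>
      mul_nonneg (patternInd_nonneg P m) (by positivity)
    rw [patternInd_of_mem ha, one_mul] at h1
    have ha1 : (1 : ℝ) ≤ a := by exact_mod_cast ha0
    calc (1 : ℝ) ≤ ((a : ℝ) + 1) * r ^ (a + 2) := by nlinarith
      _ = r * (((a : ℝ) + 1) * r ^ (a + 1)) := by ring
      _ ≤ r * patternSeries P r := mul_le_mul_of_nonneg_left h1 hr0
  have hcont : ContinuousOn (fun q => q * patternSeries P q) (Set.Icc 0 r) :=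
    continuousOn_id.mul (continuousOn_patternSeries P hr0 hr1)
  obtain ⟨q, hq, hq1⟩ := intermediate_value_Icc hr0 hcont
    (show (1 : ℝ) ∈ Set.Icc _ _ from ⟨by simp, hge⟩)
  refine ⟨q, lt_of_le_of_ne hq.1 ?_, hq.2.trans_lt hr1, hq1⟩
  rintro rfl
  simp at hq1

theorem eq_of_mul_patternSeries_eq_one {P : Set ℕ} {q r : ℝ} (hq0 : 0 < q) (hq1 : q < 1)
    (hr0 : 0 < r) (hr1 : r < 1) (hq : q * patternSeries P q = 1)
    (hr : r * patternSeries P r = 1) : q = r := by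
  have aux : ∀ {s t : ℝ}, 0 < s → t < 1 → s * patternSeries P s = 1 →
      t * patternSeries P t = 1 → ¬ s < t := by
    intro s t hs ht h1 h2 hst
    have hm := patternSeries_mono P hs.le hst.le ht
    have hp : 0 < patternSeries P s := by
      by_contra! hle
      nlinarith
    nlinarith
  exact le_antisymm (not_lt.1 (aux hr0 hq1 hr hq)) (not_lt.1 (aux hq0 hr1 hq hr))

theorem genShallitSum_const_le (P : Set ℕ) (n : ℕ) {ρ : ℝ} (hρ : 1 < ρ) :
    genShallitSum P n (fun _ => ρ) ≤
      n * (ρ + ∑' m : ℕ, patternInd P m * ρ⁻¹ ^ (m + 1)) := by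
  have hq0 : 0 ≤ ρ⁻¹ := by positivity
  have hsum : Summable fun m : ℕ => patternInd P m * ρ⁻¹ ^ (m + 1) :=
    summable_patternInd_mul P
      (by simpa using summable_pow_mul_pow_succ 0 hq0 (inv_lt_one_of_one_lt₀ hρ))
      fun m => by positivity
  have hrw : (∑ i : Fin n, ∑ j : Fin n, if i ≤ j then
        patternInd P (j.val - i.val) * ∏ k ∈ Finset.Icc i j, ρ⁻¹ else 0) =
      ∑ m ∈ Finset.range n, ∑ i ∈ Finset.range (n - m), patternInd P m * ρ⁻¹ ^ (m + 1) := by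
    rw [← sum_fin_pairs_eq_sum_diff n fun _ m => patternInd P m * ρ⁻¹ ^ (m + 1)]
    refine Finset.sum_congr rfl fun i _ => Finset.sum_congr rfl fun j _ => ?_
    split_ifs with h
    · have : j.val + 1 - i.val = j.val - i.val + 1 := by
        have : i.val ≤ j.val := h
        omega
      rw [Finset.prod_const, Fin.card_Icc, this]
    · rfl
  rw [genShallitSum_eq, hrw, mul_add]
  have h1 : ∑ _i : Fin n, ρ = n * ρ := by simp
  rw [h1]
  gcongr
  calc _ ≤ ∑ m ∈ Finset.range n, (n : ℝ) * (patternInd P m * ρ⁻¹ ^ (m + 1)) := by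
        refine Finset.sum_le_sum fun m _ => ?_
        rw [Finset.sum_const, Finset.card_range, nsmul_eq_mul]
        have := patternInd_nonneg P m
        gcongr
        exact Nat.sub_le n m
    _ = n * ∑ m ∈ Finset.range n, patternInd P m * ρ⁻¹ ^ (m + 1) := by rw [Finset.mul_sum]
    _ ≤ _ := by
        gcongr
        exact hsum.sum_le_tsum _ fun m _ => mul_nonneg (patternInd_nonneg P m) (by positivity)

theorem sum_windows_through_le (P : Set ℕ) (n : ℕ) (k : Fin n) {q : ℝ} (h0 : 0 ≤ q)
    (h1 : q < 1) :
    (∑ i : Fin n, ∑ j : Fin n, if i ≤ j then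
      (if k ∈ Finset.Icc i j then patternInd P (j.val - i.val) * q ^ (j.val - i.val + 1) else 0)
      else 0) ≤ patternSeries P q := by
  have hrw : (∑ i : Fin n, ∑ j : Fin n, if i ≤ j then
      (if k ∈ Finset.Icc i j then patternInd P (j.val - i.val) * q ^ (j.val - i.val + 1) else 0)
      else 0) = ∑ m ∈ Finset.range n, ∑ i ∈ Finset.range (n - m),
        if i ≤ k.val ∧ k.val ≤ i + m then patternInd P m * q ^ (m + 1) else 0 := by
    rw [← sum_fin_pairs_eq_sum_diff n fun i m =>
      if i ≤ k.val ∧ k.val ≤ i + m then patternInd P m * q ^ (m + 1) else 0]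
    refine Finset.sum_congr rfl fun i _ => Finset.sum_congr rfl fun j _ => ?_
    split_ifs with h h2 h3 h3
    · rfl
    · rw [Finset.mem_Icc, Fin.le_def, Fin.le_def] at h2
      omega
    · rw [Finset.mem_Icc, Fin.le_def, Fin.le_def] at h2
      rw [Fin.le_def] at h
      omega
    · rfl
    · rfl
  rw [hrw]
  calc _ ≤ ∑ m ∈ Finset.range n, patternInd P m * (((m : ℝ) + 1) * q ^ (m + 1)) := by
        refine Finset.sum_le_sum fun m _ => ?_
        have hp := patternInd_nonneg P m
        have hcard : ((Finset.range (n - m)).filter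
            (fun i => i ≤ k.val ∧ k.val ≤ i + m)).card ≤ m + 1 := by
          calc _ ≤ (Finset.Icc (k.val - m) k.val).card := by
                refine Finset.card_le_card fun i hi => ?_
                simp only [Finset.mem_filter, Finset.mem_Icc] at hi ⊢
                omega
            _ ≤ m + 1 := by
                rw [Nat.card_Icc]
                omega
        have hcard' : (((Finset.range (n - m)).filter
            (fun i => i ≤ k.val ∧ k.val ≤ i + m)).card : ℝ) ≤ m + 1 := by exact_mod_cast hcard
        rw [← Finset.sum_filter, Finset.sum_const, nsmul_eq_mul]
        calc _ ≤ ((m : ℝ) + 1) * (patternInd P m * q ^ (m + 1)) := by gcongr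
          _ = _ := by ring
    _ ≤ _ := (summable_patternSeries P h0 h1).sum_le_tsum _ fun m _ =>
        mul_nonneg (patternInd_nonneg P m) (by positivity)

theorem sum_windows_le_genShallitSum (P : Set ℕ) (n : ℕ) {ρ : ℝ} (hρ : 1 < ρ)
    (hroot : patternSeries P ρ⁻¹ ≤ ρ) (x : Fin n → ℝ) (hx : ∀ i, 0 < x i) :
    (∑ i : Fin n, ∑ j : Fin n, if i ≤ j then
      patternInd P (j.val - i.val) * ((((j.val - i.val : ℕ) : ℝ) + 2) * ρ⁻¹ ^ (j.val - i.val + 1))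
      else 0) ≤ genShallitSum P n x := by
  have hρ0 : 0 < ρ := by positivity
  have hq0 : 0 ≤ ρ⁻¹ := by positivity
  have hq1 : ρ⁻¹ < 1 := inv_lt_one_of_one_lt₀ hρ
  set b : Fin n → Fin n → ℝ := fun i j =>
    patternInd P (j.val - i.val) * ρ⁻¹ ^ (j.val - i.val + 1) with hb
  have hb0 : ∀ i j, 0 ≤ b i j := fun i j => mul_nonneg (patternInd_nonneg P _) (by positivity)
  set t : Fin n → ℝ := fun k => Real.log (x k / ρ) with ht
  have hxt : ∀ k, x k = ρ * Real.exp (t k) := by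
    intro k
    rw [ht, Real.exp_log (div_pos (hx k) hρ0)]
    field_simp
  set w : Fin n → ℝ := fun k => ∑ i : Fin n, ∑ j : Fin n, if i ≤ j then
    (if k ∈ Finset.Icc i j then b i j else 0) else 0 with hw
  have hw0 : ∀ k, 0 ≤ w k := by
    intro k
    refine Finset.sum_nonneg fun i _ => Finset.sum_nonneg fun j _ => ?_
    have := hb0 i j
    split_ifs <;> first | exact this | exact le_rfl
  have hwle : ∀ k, w k ≤ ρ := fun k => (sum_windows_through_le P n k hq0 hq1).trans hroot
  have hlin : ∑ k, w k * (1 + t k) ≤ ∑ k, x k := by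
    refine Finset.sum_le_sum fun k _ => ?_
    have h1 : 1 + t k ≤ Real.exp (t k) := by linarith [Real.add_one_le_exp (t k)]
    calc w k * (1 + t k) ≤ w k * Real.exp (t k) := mul_le_mul_of_nonneg_left h1 (hw0 k)
      _ ≤ ρ * Real.exp (t k) := by gcongr; exact hwle k
      _ = x k := (hxt k).symm
  have hswap : ∑ k, w k * (1 + t k) = ∑ i : Fin n, ∑ j : Fin n, if i ≤ j then
      b i j * ∑ k ∈ Finset.Icc i j, (1 + t k) else 0 := by
    simp only [hw, Finset.sum_mul]
    rw [Finset.sum_comm]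
    refine Finset.sum_congr rfl fun i _ => ?_
    rw [Finset.sum_comm]
    refine Finset.sum_congr rfl fun j _ => ?_
    split_ifs with h
    · rw [Finset.mul_sum]
      simp only [ite_mul, zero_mul]
      rw [← Finset.sum_filter]
      refine Finset.sum_congr ?_ fun _ _ => rfl
      ext k
      simp
    · simp
  rw [genShallitSum_eq]
  refine le_trans ?_ (add_le_add_left (hswap ▸ hlin) _)
  rw [← Finset.sum_add_distrib]
  refine Finset.sum_le_sum fun i _ => ?_
  rw [← Finset.sum_add_distrib]
  refine Finset.sum_le_sum fun j _ => ?_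
  split_ifs with h
  · have hcard : (Finset.Icc i j).card = j.val - i.val + 1 := by
      have : i.val ≤ j.val := h
      rw [Fin.card_Icc]
      omega
    have hprod : ∏ k ∈ Finset.Icc i j, (x k)⁻¹ =
        ρ⁻¹ ^ (j.val - i.val + 1) * Real.exp (-∑ k ∈ Finset.Icc i j, t k) := by
      rw [← Finset.sum_neg_distrib, Real.exp_sum, ← hcard, ← Finset.prod_const,
        ← Finset.prod_mul_distrib]
      refine Finset.prod_congr rfl fun k _ => ?_
      rw [hxt k, mul_inv, Real.exp_neg]
    have hexp := mul_le_mul_of_nonneg_left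
      (Real.add_one_le_exp (-∑ k ∈ Finset.Icc i j, t k)) (hb0 i j)
    have hsum : ∑ k ∈ Finset.Icc i j, (1 + t k) =
        ((j.val - i.val : ℕ) : ℝ) + 1 + ∑ k ∈ Finset.Icc i j, t k := by
      rw [Finset.sum_add_distrib, Finset.sum_const, hcard]
      simp
    rw [hprod, hsum, ← mul_assoc (patternInd P _) _ (Real.exp _)]
    calc _ = b i j * (((j.val - i.val : ℕ) : ℝ) + 1 + ∑ k ∈ Finset.Icc i j, t k) +
          b i j * (-∑ k ∈ Finset.Icc i j, t k + 1) := by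
          simp only [hb]
          ring
      _ ≤ _ := add_le_add le_rfl hexp
  · simp

theorem summable_add_two_mul_pow {q : ℝ} (h0 : 0 ≤ q) (h1 : q < 1) :
    Summable fun m : ℕ => ((m : ℝ) + 2) * q ^ (m + 1) := by
  refine ((summable_pow_mul_pow_succ 1 h0 h1).add
    ((summable_pow_mul_pow_succ 0 h0 h1).mul_left 2)).congr fun m => ?_
  ring

theorem summable_mul_add_two_mul_pow {q : ℝ} (h0 : 0 ≤ q) (h1 : q < 1) :
    Summable fun m : ℕ => (m : ℝ) * (((m : ℝ) + 2) * q ^ (m + 1)) := by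
  refine ((summable_pow_mul_pow_succ 2 h0 h1).add
    ((summable_pow_mul_pow_succ 1 h0 h1).mul_left 2)).congr fun m => ?_
  ring

theorem le_genShallitSum (P : Set ℕ) (n : ℕ) {ρ : ℝ} (hρ : 1 < ρ)
    (hroot : patternSeries P ρ⁻¹ ≤ ρ) (x : Fin n → ℝ) (hx : ∀ i, 0 < x i) :
    n * (∑' m : ℕ, patternInd P m * (((m : ℝ) + 2) * ρ⁻¹ ^ (m + 1))) -
      ∑' m : ℕ, patternInd P m * ((m : ℝ) * (((m : ℝ) + 2) * ρ⁻¹ ^ (m + 1))) ≤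
      genShallitSum P n x := by
  have hq0 : 0 ≤ ρ⁻¹ := by positivity
  have hq1 : ρ⁻¹ < 1 := inv_lt_one_of_one_lt₀ hρ
  have hs1 := summable_patternInd_mul P (summable_add_two_mul_pow hq0 hq1)
    fun m => by positivity
  have hs2 := summable_patternInd_mul P (summable_mul_add_two_mul_pow hq0 hq1)
    fun m => by positivity
  refine le_trans ?_ (sum_windows_le_genShallitSum P n hρ hroot x hx)
  rw [sum_fin_pairs_eq_sum_diff n fun _ m =>
    patternInd P m * (((m : ℝ) + 2) * ρ⁻¹ ^ (m + 1)), ← tsum_mul_left,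
    ← (hs1.mul_left (n : ℝ)).tsum_sub hs2]
  have hs := (hs1.mul_left (n : ℝ)).sub hs2
  have htail : ∀ m ∉ Finset.range n,
      (n : ℝ) * (patternInd P m * (((m : ℝ) + 2) * ρ⁻¹ ^ (m + 1))) -
        patternInd P m * ((m : ℝ) * (((m : ℝ) + 2) * ρ⁻¹ ^ (m + 1))) ≤ 0 := by
    intro m hm
    have hnm : (n : ℝ) ≤ m := by
      rw [Finset.mem_range, not_lt] at hm
      exact_mod_cast hm
    have h0 : 0 ≤ patternInd P m * (((m : ℝ) + 2) * ρ⁻¹ ^ (m + 1)) :=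
      mul_nonneg (patternInd_nonneg P m) (by positivity)
    linarith [mul_le_mul_of_nonneg_right hnm h0]
  have hle := hs.neg.sum_le_tsum (Finset.range n) fun m hm => neg_nonneg.2 (htail m hm)
  rw [tsum_neg, Finset.sum_neg_distrib, neg_le_neg_iff] at hle
  refine hle.trans (Finset.sum_le_sum fun m hm => ?_)
  rw [Finset.sum_const, Finset.card_range, nsmul_eq_mul,
    Nat.cast_sub (Finset.mem_range.1 hm).le]
  exact le_of_eq (by ring)

/-- Crude asymptotics of the generalized Shallit problem: the equation
`ρ = ∑_{m ∈ P} (m+1) ρ^(-m-1)` has a unique root `ρ_P > 1`, and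
`m_n(P)/n → λ_P = ρ_P + ∑_{m ∈ P} ρ_P^(-m-1)`. -/
theorem genShallit_crude_asymptotics
    (P : Set ℕ) (hP : P.Nonempty) (hpos : ∃ m ∈ P, 0 < m) :
    (∃! ρ : ℝ, 1 < ρ ∧
      ρ = ∑' m : P, (((m : ℕ) : ℝ) + 1) * ρ ^ (-((m : ℕ) : ℤ) - 1)) ∧
    ∀ ρ : ℝ,
      (1 < ρ ∧ ρ = ∑' m : P, (((m : ℕ) : ℝ) + 1) * ρ ^ (-((m : ℕ) : ℤ) - 1)) →
      Filter.Tendsto (fun n : ℕ => genShallitMin P n / n) Filter.atTop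
        (nhds (ρ + ∑' m : P, ρ ^ (-((m : ℕ) : ℤ) - 1))) := by
  have hiff : ∀ ρ : ℝ, 1 < ρ →
      (ρ = ∑' m : P, (((m : ℕ) : ℝ) + 1) * ρ ^ (-((m : ℕ) : ℤ) - 1) ↔
        ρ⁻¹ * patternSeries P ρ⁻¹ = 1) := by
    intro ρ hρ
    have hρ0 : ρ ≠ 0 := by positivity
    rw [tsum_pattern P (fun m => (m : ℝ) + 1) ρ]
    change ρ = patternSeries P ρ⁻¹ ↔ _
    rw [inv_mul_eq_one₀ hρ0]
  refine ⟨?_, ?_⟩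
  · obtain ⟨q, hq0, hq1, hq⟩ := exists_mul_patternSeries_eq_one hpos
    have h1 : 1 < q⁻¹ := (one_lt_inv₀ hq0).2 hq1
    refine ⟨q⁻¹, ⟨h1, (hiff _ h1).2 (by rwa [inv_inv])⟩, ?_⟩
    rintro ρ ⟨hρ, hroot⟩
    rw [← eq_of_mul_patternSeries_eq_one (inv_pos.2 (by positivity))
      (inv_lt_one_of_one_lt₀ hρ) hq0 hq1 ((hiff ρ hρ).1 hroot) hq, inv_inv]
  · rintro ρ ⟨hρ, hroot⟩
    have hρ0 : 0 < ρ := by positivity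
    have hq0 : 0 ≤ ρ⁻¹ := by positivity
    have hq1 : ρ⁻¹ < 1 := inv_lt_one_of_one_lt₀ hρ
    rw [tsum_pattern P (fun m => (m : ℝ) + 1) ρ] at hroot
    have hroot' : ρ = patternSeries P ρ⁻¹ := hroot
    have hA := tsum_pattern P (fun _ => 1) ρ
    simp only [one_mul] at hA
    rw [hA]
    have hlam : ∑' m : ℕ, patternInd P m * (((m : ℝ) + 2) * ρ⁻¹ ^ (m + 1)) =
        ρ + ∑' m : ℕ, patternInd P m * ρ⁻¹ ^ (m + 1) := by
      have hsum : Summable fun m : ℕ => patternInd P m * ρ⁻¹ ^ (m + 1) :=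
        summable_patternInd_mul P (by simpa using summable_pow_mul_pow_succ 0 hq0 hq1)
          fun m => by positivity
      have hsplit : ∑' m : ℕ, patternInd P m * (((m : ℝ) + 2) * ρ⁻¹ ^ (m + 1)) =
          patternSeries P ρ⁻¹ + ∑' m : ℕ, patternInd P m * ρ⁻¹ ^ (m + 1) := by
        unfold patternSeries
        rw [← (summable_patternSeries P hq0 hq1).tsum_add hsum]
        exact tsum_congr fun m => by ring
      rw [hsplit, ← hroot']
    set lam := ρ + ∑' m : ℕ, patternInd P m * ρ⁻¹ ^ (m + 1)
    set C := ∑' m : ℕ, patternInd P m * ((m : ℝ) * (((m : ℝ) + 2) * ρ⁻¹ ^ (m + 1)))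
    have hlow : ∀ n : ℕ, ∀ x : Fin n → ℝ, (∀ i, 0 < x i) →
        n * lam - C ≤ genShallitSum P n x := by
      intro n x hx
      have h := le_genShallitSum P n hρ hroot'.ge x hx
      rwa [hlam] at h
    have hmin_low : ∀ n : ℕ, n * lam - C ≤ genShallitMin P n := by
      intro n
      refine le_csInf ⟨_, fun _ => 1, fun _ => one_pos, rfl⟩ ?_
      rintro s ⟨x, hx, rfl⟩
      exact hlow n x hx
    have hmin_up : ∀ n : ℕ, genShallitMin P n ≤ n * lam := by
      intro n
      refine le_trans ?_ (genShallitSum_const_le P n hρ)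
      unfold genShallitMin
      refine csInf_le ⟨n * lam - C, ?_⟩ ⟨fun _ => ρ, fun _ => hρ0, rfl⟩
      rintro s ⟨x, hx, rfl⟩
      exact hlow n x hx
    have hlim : Filter.Tendsto (fun n : ℕ => lam - C / n) Filter.atTop (nhds lam) := by
      simpa using tendsto_const_nhds.sub (tendsto_const_div_atTop_nhds_zero_nat C)
    refine tendsto_of_tendsto_of_tendsto_of_le_of_le' hlim tendsto_const_nhds ?_ ?_
    · filter_upwards [Filter.eventually_gt_atTop 0] with n hn
      have hn' : (0 : ℝ) < n := by exact_mod_cast hn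
      rw [le_div_iff₀ hn', sub_mul, div_mul_cancel₀ _ hn'.ne']
      linarith [hmin_low n]
    · filter_upwards [Filter.eventually_gt_atTop 0] with n hn
      have hn' : (0 : ℝ) < n := by exact_mod_cast hn
      rw [div_le_iff₀ hn']
      linarith [hmin_up n]
end
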